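/- Let (d,k) satisfy either (d ∈ {1,2,3} and k = 2) or (d = 1 and k = 3), and let s satisfy d(1/2 − 1/k) − 1/k < s ≤ 0. Then vNLW is locally well-posed in 𝓗^s(ℝ^d): there is a constant C such that for every R > 0 there exists T ∈ (0,1) such that for every (u₀,u₁) ∈ 𝓗^s(ℝ^d) with ‖(u₀,u₁)‖_{𝓗^s} ≤ R there is a unique u with u ∈ C([0,T]; H^s(ℝ^d)), with ‖u‖_{X(T)} := ‖u‖_{C([0,T];H^s)} + sup_{0<t<T} t^{−s+d(1/2−1/k)} ‖ |ξ|^{d(1/2−1/k)} û(t,ξ) ‖_{L²_ξ} ≤ 2CR, satisfying for all t ∈ [0,T] and a.e. ξ the Duhamel formulation û(t,ξ) = e^{−|ξ|t/2}[cos((√3/2)|ξ|t) + (1/√3)sin((√3/2)|ξ|t)]û₀(ξ) + e^{−|ξ|t/2}·(sin((√3/2)|ξ|t)/((√3/2)|ξ|))·û₁(ξ) − ∫₀^t e^{−|ξ|(t−t')/2}·(sin((√3/2)|ξ|(t−t'))/((√3/2)|ξ|))·\widehat{u(t')^k}(ξ) dt' (the product u(t')^k is a well-defined L¹ function since u(t')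 ∈ L^k(ℝ^d) for 0 < t' < T, by the embedding Ḣ^{d(1/2−1/k)}(ℝ^d) ↪ L^k(ℝ^d)); moreover the data-to-solution map is Lipschitz continuous from this ball of 𝓗^s into C([0,T]; H^s). -/

import Mathlib

open MeasureTheory Real Set Filter Topology
open scoped ENNReal NNReal BigOperators

noncomputable section

/-- Frequency space `ℝ^d` with the Euclidean norm. -/
abbrev Edim (d : ℕ) := EuclideanSpace ℝ (Fin d)

/-! We work entirely on the Fourier side: a function `f` on `ℝ^d` is represented by
its Fourier transform `F = f̂ : ℝ^d → ℂ`. -/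

/-- Squared `H^s` norm, computed on the Fourier side:
`‖f‖_{H^s}² = ∫ ⟨ξ⟩^{2s} |f̂(ξ)|² dξ`. -/
def HsNormSq (d : ℕ) (s : ℝ) (F : Edim d → ℂ) : ℝ≥0∞ :=
  ∫⁻ ξ, ENNReal.ofReal ((1 + ‖ξ‖ ^ 2) ^ s * ‖F ξ‖ ^ 2)

/-- `H^s` norm on the Fourier side. -/
def HsNorm (d : ℕ) (s : ℝ) (F : Edim d → ℂ) : ℝ≥0∞ :=
  HsNormSq d s F ^ (1 / 2 : ℝ)

/-- Norm of `𝓗^s = H^s × H^{s-1}` on the Fourier side. -/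
def pairHsNorm (d : ℕ) (s : ℝ) (F G : Edim d → ℂ) : ℝ≥0∞ :=
  (HsNormSq d s F + HsNormSq d (s - 1) G) ^ (1 / 2 : ℝ)

/-- Membership in `H^s`, on the Fourier side. -/
def MemHs (d : ℕ) (s : ℝ) (F : Edim d → ℂ) : Prop :=
  Measurable F ∧ HsNormSq d s F < ⊤

/-- Membership in `𝓗^s = H^s × H^{s-1}`, on the Fourier side. -/
def MemHsPair (d : ℕ) (s : ℝ) (F G : Edim d → ℂ) : Prop :=
  MemHs d s F ∧ MemHs d (s - 1) G

/-- The Wiener-algebra norm `‖f‖_{FL^{0,1}} = ‖f̂‖_{L¹}`, on the Fourier side. -/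
def FLNorm (d : ℕ) (F : Edim d → ℂ) : ℝ≥0∞ :=
  ∫⁻ ξ, (‖F ξ‖₊ : ℝ≥0∞)

/-- The norm `‖g‖_{FL^{-1,1}} = ‖⟨ξ⟩⁻¹ ĝ‖_{L¹}`, on the Fourier side. -/
def FLm1Norm (d : ℕ) (F : Edim d → ℂ) : ℝ≥0∞ :=
  ∫⁻ ξ, ENNReal.ofReal ((1 + ‖ξ‖ ^ 2) ^ (-(1 : ℝ) / 2) * ‖F ξ‖)

/-- Norm of `F⃗L¹ = FL^{0,1} × FL^{-1,1}`. -/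
def pairFLNorm (d : ℕ) (F G : Edim d → ℂ) : ℝ≥0∞ :=
  FLNorm d F + FLm1Norm d G

/-- Membership in `F⃗L¹ = FL^{0,1} × FL^{-1,1}`, on the Fourier side. -/
def MemFLPair (d : ℕ) (F G : Edim d → ℂ) : Prop :=
  Measurable F ∧ Measurable G ∧ pairFLNorm d F G < ⊤

/-- Symbol of `V₀(t)`: `cos((√3/2)|ξ|t) + (1/√3) sin((√3/2)|ξ|t)`. -/
def V0sym (t r : ℝ) : ℝ :=
  Real.cos (Real.sqrt 3 / 2 * r * t) + 1 / Real.sqrt 3 * Real.sin (Real.sqrt 3 / 2 * r * t)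

/-- Symbol of `V₁(t)`: `sin((√3/2)|ξ|t) / ((√3/2)|ξ|)`. -/
def V1sym (t r : ℝ) : ℝ :=
  Real.sin (Real.sqrt 3 / 2 * r * t) / (Real.sqrt 3 / 2 * r)

/-- Symbol of the Poisson kernel `P(t)`: `e^{-|ξ|t/2}`. -/
def Psym (t r : ℝ) : ℝ := Real.exp (-(r * t) / 2)

/-- Symbol of `W(t) = P(t)V₁(t)`. -/
def Wsym (t r : ℝ) : ℝ := Psym t r * V1sym t r

/-- Fourier side of the linear flow `V(t)(u₀,u₁) = P(t)(V₀(t)u₀ + V₁(t)u₁)`. -/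
def Vflow (d : ℕ) (F₀ F₁ : Edim d → ℂ) (t : ℝ) (ξ : Edim d) : ℂ :=
  ((Psym t ‖ξ‖ * V0sym t ‖ξ‖ : ℝ) : ℂ) * F₀ ξ + ((Psym t ‖ξ‖ * V1sym t ‖ξ‖ : ℝ) : ℂ) * F₁ ξ

/-- Convolution on `ℝ^d`. -/
def conv (d : ℕ) (f g : Edim d → ℂ) (ξ : Edim d) : ℂ :=
  ∫ η, f (ξ - η) * g η

/-- `convIter d f n` is the `(n+1)`-fold convolution `f ∗ ⋯ ∗ f`. -/
def convIter (d : ℕ) (f : Edim d → ℂ) : ℕ → Edim d → ℂ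
  | 0 => f
  | n + 1 => conv d (convIter d f n) f

/-- Convolution of a (nonempty) list of functions. -/
def listConv (d : ℕ) : List (Edim d → ℂ) → Edim d → ℂ
  | [] => fun _ => 0
  | f :: fs => fs.foldl (conv d) f

/-- Fourier side of the Duhamel operator
`I_k(u₁,…,u_k)(t) = -∫₀ᵗ W(t-t') ∏ u_j(t') dt'`. -/
def Ik (d k : ℕ) (us : Fin k → ℝ → Edim d → ℂ) (t : ℝ) (ξ : Edim d) : ℂ :=
  -(∫ t' in (0 : ℝ)..t,
      ((Wsym (t - t') ‖ξ‖ : ℝ) : ℂ) * listConv d (List.ofFn fun i => us i t') ξ)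

/-- Picard iterates `Ξ_j` of vNLW, on the Fourier side:
`Ξ₀(u⃗₀)(t) = V(t)u⃗₀` and
`Ξ_j(u⃗₀) = ∑_{j₁+⋯+j_k = j-1} I_k(Ξ_{j₁}(u⃗₀),…,Ξ_{j_k}(u⃗₀))`. -/
def Xi (d k : ℕ) (F₀ F₁ : Edim d → ℂ) : ℕ → ℝ → Edim d → ℂ
  | 0 => Vflow d F₀ F₁
  | j + 1 => fun t ξ =>
      ∑ l ∈ (Finset.Nat.antidiagonalTuple k j).attach,
        Ik d k (fun i => Xi d k F₀ F₁ (l.1 i)) t ξ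
  decreasing_by
    have h := Finset.Nat.mem_antidiagonalTuple.mp l.2
    have hle := Finset.single_le_sum (f := l.1) (fun j _ => Nat.zero_le (l.1 j))
      (Finset.mem_univ i)
    omega

/-- `u : [0,T] → FL^{0,1}(ℝ^d)` (represented on the Fourier side) is a Duhamel solution
of vNLW with nonlinearity `-u^k` and initial data `(u₀,u₁)` with `û₀ = F₀`, `û₁ = F₁`. -/
structure IsDuhamelSolution (d k : ℕ) (T : ℝ) (F₀ F₁ : Edim d → ℂ)
    (u : ℝ → Edim d → ℂ) : Prop where
  measurable : ∀ t ∈ Set.Icc (0 : ℝ) T, Measurable (u t)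
  finite : ∀ t ∈ Set.Icc (0 : ℝ) T, FLNorm d (u t) < ⊤
  continuous : ∀ t₀ ∈ Set.Icc (0 : ℝ) T, ∀ ε : ℝ, 0 < ε → ∃ δ : ℝ, 0 < δ ∧
    ∀ t ∈ Set.Icc (0 : ℝ) T, |t - t₀| < δ →
      FLNorm d (fun ξ => u t ξ - u t₀ ξ) < ENNReal.ofReal ε
  duhamel : ∀ t ∈ Set.Icc (0 : ℝ) T, ∀ᵐ ξ : Edim d, u t ξ =
    ((Psym t ‖ξ‖ * V0sym t ‖ξ‖ : ℝ) : ℂ) * F₀ ξ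
      + ((Psym t ‖ξ‖ * V1sym t ‖ξ‖ : ℝ) : ℂ) * F₁ ξ
      - ∫ t' in (0 : ℝ)..t,
          ((Wsym (t - t') ‖ξ‖ : ℝ) : ℂ) * convIter d (u t') (k - 1) ξ

/-- The cube `Q_A = [-A/8, A/8]^d`. -/
def cubeSet (d : ℕ) (A : ℝ) : Set (Edim d) := {ξ | ∀ i, |ξ i| ≤ A / 8}

/-- `Ω = ⋃_{η ∈ Σ} (η + Q_A)` with `Σ = {-2Ne₁, -Ne₁, Ne₁, 2Ne₁}`. -/
def OmegaSet (d : ℕ) (N A : ℝ) : Set (Edim d) :=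
  {ξ | ∃ c : ℝ, (c = -2 * N ∨ c = -N ∨ c = N ∨ c = 2 * N) ∧
    ∀ i : Fin d, |ξ i - (if (i : ℕ) = 0 then c else 0)| ≤ A / 8}

/-- `Ω_k = ⋃_{η ∈ Σ_k} (η + Q_A)` with `Σ_k = {-Ne₁, Ne₁}` for even `k` and
`Σ_k = {-2Ne₁, -Ne₁, Ne₁, 2Ne₁}` for odd `k`. -/
def OmegaKSet (d k : ℕ) (N A : ℝ) : Set (Edim d) :=
  {ξ | ∃ c : ℝ, (if k % 2 = 0 then c = -N ∨ c = N
      else c = -2 * N ∨ c = -N ∨ c = N ∨ c = 2 * N) ∧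
    ∀ i : Fin d, |ξ i - (if (i : ℕ) = 0 then c else 0)| ≤ A / 8}

/-- `φ̂ = R·𝟙_Ω`. -/
def phiHat (d : ℕ) (N A R : ℝ) : Edim d → ℂ :=
  Set.indicator (OmegaSet d N A) fun _ => (R : ℂ)

/-- `φ̂ = R·𝟙_{Ω_k}`. -/
def phiHatK (d k : ℕ) (N A R : ℝ) : Edim d → ℂ :=
  Set.indicator (OmegaKSet d k N A) fun _ => (R : ℂ)

/-- `g_s(A)`: `1` if `s < -d/2`; `(log⟨A⟩)^{1/2}` if `s = -d/2`; `A^{d/2+s}` if `s > -d/2`. -/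
def gs (d : ℕ) (s A : ℝ) : ℝ :=
  if s < -(d : ℝ) / 2 then 1
  else if s = -(d : ℝ) / 2 then Real.sqrt (Real.log (Real.sqrt (1 + A ^ 2)))
  else A ^ ((d : ℝ) / 2 + s)


/-- Squared homogeneous Sobolev norm `‖f‖_{Ḣ^σ}² = ∫ |ξ|^{2σ} |f̂(ξ)|² dξ`,
on the Fourier side. -/
def HdotNormSq (d : ℕ) (σ : ℝ) (F : Edim d → ℂ) : ℝ≥0∞ :=
  ∫⁻ ξ, ENNReal.ofReal (‖ξ‖ ^ (2 * σ) * ‖F ξ‖ ^ 2)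

/-- Homogeneous Sobolev norm `Ḣ^σ`, on the Fourier side. -/
def HdotNorm (d : ℕ) (σ : ℝ) (F : Edim d → ℂ) : ℝ≥0∞ :=
  HdotNormSq d σ F ^ (1 / 2 : ℝ)

/-- The `X(T)` norm:
`‖u‖_{X(T)} = ‖u‖_{C([0,T];H^s)} + sup_{0<t<T} t^{-s+d(1/2-1/k)} ‖u(t)‖_{Ḣ^{d(1/2-1/k)}}`. -/
def XNorm (d k : ℕ) (s T : ℝ) (u : ℝ → Edim d → ℂ) : ℝ≥0∞ :=
  (⨆ t ∈ Set.Icc (0 : ℝ) T, HsNorm d s (u t)) +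
    ⨆ t ∈ Set.Ioo (0 : ℝ) T,
      ENNReal.ofReal (t ^ (-s + (d : ℝ) * (1 / 2 - 1 / (k : ℝ)))) *
        HdotNorm d ((d : ℝ) * (1 / 2 - 1 / (k : ℝ))) (u t)

/-- The properties characterizing the solution in Theorem 1.3:
`u ∈ C([0,T]; H^s)`, `‖u‖_{X(T)} ≤ B`, and `u` satisfies the Duhamel formulation
of vNLW (on the Fourier side, where `\widehat{u(t')^k}` is the `k`-fold convolution). -/
def SolProps (d k : ℕ) (s T B : ℝ) (F₀ F₁ : Edim d → ℂ) (u : ℝ → Edim d → ℂ) : Prop :=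
  (∀ t ∈ Set.Icc (0 : ℝ) T, Measurable (u t) ∧ HsNormSq d s (u t) < ⊤) ∧
  (∀ t₀ ∈ Set.Icc (0 : ℝ) T, ∀ ε : ℝ, 0 < ε → ∃ δ : ℝ, 0 < δ ∧
    ∀ t ∈ Set.Icc (0 : ℝ) T, |t - t₀| < δ →
      HsNorm d s (fun ξ => u t ξ - u t₀ ξ) < ENNReal.ofReal ε) ∧
  XNorm d k s T u ≤ ENNReal.ofReal B ∧
  (∀ t ∈ Set.Icc (0 : ℝ) T, ∀ᵐ ξ : Edim d, u t ξ =
    ((Psym t ‖ξ‖ * V0sym t ‖ξ‖ : ℝ) : ℂ) * F₀ ξ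
      + ((Psym t ‖ξ‖ * V1sym t ‖ξ‖ : ℝ) : ℂ) * F₁ ξ
      - ∫ t' in (0 : ℝ)..t,
          ((Wsym (t - t') ‖ξ‖ : ℝ) : ℂ) * convIter d (u t') (k - 1) ξ)

/-- The Japanese bracket power `⟨ξ⟩ ^ s`. -/
def bracket (d : ℕ) (s : ℝ) (ξ : Edim d) : ℝ := (1 + ‖ξ‖ ^ 2) ^ (s / 2)

section Norms

variable {d : ℕ}

lemma bracket_pos (s : ℝ) (ξ : Edim d) : 0 < bracket d s ξ := by
  unfold bracket; positivity

lemma measurable_bracket (s : ℝ) : Measurable (bracket d s) := by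
  unfold bracket; fun_prop

lemma bracket_add (s r : ℝ) (ξ : Edim d) : bracket d (s + r) ξ = bracket d s ξ * bracket d r ξ := by
  unfold bracket
  rw [add_div, Real.rpow_add (by positivity)]

lemma norm_rpow_le_bracket {σ : ℝ} (hσ : 0 ≤ σ) (ξ : Edim d) : ‖ξ‖ ^ σ ≤ bracket d σ ξ := by
  unfold bracket
  calc ‖ξ‖ ^ σ = (‖ξ‖ ^ 2) ^ (σ / 2) := by
        rw [← Real.rpow_natCast, ← Real.rpow_mul (norm_nonneg _)]; congr 1; push_cast; ring
    _ ≤ _ := by gcongr; linarith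

lemma HsNorm_eq_eLpNorm (s : ℝ) (F : Edim d → ℂ) :
    HsNorm d s F = eLpNorm (fun ξ => bracket d s ξ • F ξ) 2 volume := by
  rw [eLpNorm_eq_lintegral_rpow_enorm_toReal (by norm_num) (by norm_num), HsNorm, HsNormSq]
  simp only [ENNReal.toReal_ofNat]
  congr 1
  refine lintegral_congr fun ξ => ?_
  rw [← ofReal_norm, ENNReal.ofReal_rpow_of_nonneg (norm_nonneg _) (by norm_num)]
  congr 1
  rw [norm_smul, Real.norm_of_nonneg (bracket_pos s ξ).le, Real.mul_rpow (bracket_pos s ξ).le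
    (norm_nonneg _), bracket, ← Real.rpow_mul (by positivity)]
  norm_num

lemma HdotNorm_eq_eLpNorm (σ : ℝ) (F : Edim d → ℂ) :
    HdotNorm d σ F = eLpNorm (fun ξ => ‖ξ‖ ^ σ • F ξ) 2 volume := by
  rw [eLpNorm_eq_lintegral_rpow_enorm_toReal (by norm_num) (by norm_num), HdotNorm, HdotNormSq]
  simp only [ENNReal.toReal_ofNat]
  congr 1
  refine lintegral_congr fun ξ => ?_
  rw [← ofReal_norm, ENNReal.ofReal_rpow_of_nonneg (norm_nonneg _) (by norm_num)]
  congr 1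
  rw [norm_smul, Real.norm_of_nonneg (by positivity), Real.mul_rpow (by positivity)
    (norm_nonneg _), ← Real.rpow_mul (by positivity)]
  norm_num [mul_comm]

lemma HsNorm_lt_top_iff {s : ℝ} {F : Edim d → ℂ} : HsNorm d s F < ⊤ ↔ HsNormSq d s F < ⊤ := by
  rw [HsNorm, ENNReal.rpow_lt_top_iff_of_pos (by norm_num)]

lemma aesm_bracket {s : ℝ} {F : Edim d → ℂ} (hF : Measurable F) :
    AEStronglyMeasurable (fun ξ => bracket d s ξ • F ξ) volume :=
  ((measurable_bracket s).smul hF).aestronglyMeasurable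

lemma aesm_norm_rpow {σ : ℝ} {F : Edim d → ℂ} (hF : Measurable F) :
    AEStronglyMeasurable (fun ξ => ‖ξ‖ ^ σ • F ξ) volume :=
  ((by fun_prop : Measurable fun ξ : Edim d => ‖ξ‖ ^ σ).smul hF).aestronglyMeasurable

lemma HsNorm_congr_ae {s : ℝ} {F G : Edim d → ℂ} (h : F =ᵐ[volume] G) :
    HsNorm d s F = HsNorm d s G := by
  rw [HsNorm_eq_eLpNorm, HsNorm_eq_eLpNorm]
  exact eLpNorm_congr_ae (h.mono fun ξ hξ => by simp only [hξ])

lemma HdotNorm_congr_ae {s : ℝ} {F G : Edim d → ℂ} (h : F =ᵐ[volume] G) :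
    HdotNorm d s F = HdotNorm d s G := by
  rw [HdotNorm_eq_eLpNorm, HdotNorm_eq_eLpNorm]
  exact eLpNorm_congr_ae (h.mono fun ξ hξ => by simp only [hξ])

lemma HsNorm_add_le {s : ℝ} {F G : Edim d → ℂ} (hF : Measurable F) (hG : Measurable G) :
    HsNorm d s (fun ξ => F ξ + G ξ) ≤ HsNorm d s F + HsNorm d s G := by
  simp only [HsNorm_eq_eLpNorm, smul_add]
  exact eLpNorm_add_le (aesm_bracket hF) (aesm_bracket hG) (by norm_num)

lemma HsNorm_sub_le {s : ℝ} {F G : Edim d → ℂ} (hF : Measurable F) (hG : Measurable G) :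
    HsNorm d s (fun ξ => F ξ - G ξ) ≤ HsNorm d s F + HsNorm d s G := by
  simp only [HsNorm_eq_eLpNorm, smul_sub]
  exact eLpNorm_sub_le (aesm_bracket hF) (aesm_bracket hG) (by norm_num)

lemma HdotNorm_add_le {s : ℝ} {F G : Edim d → ℂ} (hF : Measurable F) (hG : Measurable G) :
    HdotNorm d s (fun ξ => F ξ + G ξ) ≤ HdotNorm d s F + HdotNorm d s G := by
  simp only [HdotNorm_eq_eLpNorm, smul_add]
  exact eLpNorm_add_le (aesm_norm_rpow hF) (aesm_norm_rpow hG) (by norm_num)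

lemma HsNorm_eq_zero {s : ℝ} {F : Edim d → ℂ} (hF : Measurable F) (h : HsNorm d s F = 0) :
    F =ᵐ[volume] 0 := by
  rw [HsNorm_eq_eLpNorm, eLpNorm_eq_zero_iff (aesm_bracket hF) (by norm_num)] at h
  exact h.mono fun ξ hξ => by simpa [(bracket_pos s ξ).ne'] using hξ

lemma HsNorm_zero (s : ℝ) : HsNorm d s (fun _ => 0) = 0 := by
  simp [HsNorm_eq_eLpNorm]

lemma HdotNorm_zero (s : ℝ) : HdotNorm d s (fun _ => 0) = 0 := by
  simp [HdotNorm_eq_eLpNorm]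

lemma HsNorm_le_pairHsNorm (s : ℝ) (F G : Edim d → ℂ) : HsNorm d s F ≤ pairHsNorm d s F G := by
  unfold HsNorm pairHsNorm; gcongr; exact le_self_add

lemma HsNorm_le_pairHsNorm' (s : ℝ) (F G : Edim d → ℂ) :
    HsNorm d (s - 1) G ≤ pairHsNorm d s F G := by
  unfold HsNorm pairHsNorm; gcongr; exact le_add_self

lemma bracket_mul_HsNorm (s r : ℝ) (F : Edim d → ℂ) :
    HsNorm d s (fun ξ => bracket d r ξ • F ξ) = HsNorm d (s + r) F := by
  simp only [HsNorm_eq_eLpNorm, bracket_add, smul_smul]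

/-- The function `⟨ξ⟩ ^ (-γ)` lies in `H^s` when `d / 2 + s < γ`. -/
lemma HsNorm_bracket_lt_top {s γ : ℝ} (h : (d : ℝ) / 2 + s < γ) :
    HsNorm d s (fun ξ => (bracket d (-γ) ξ : ℂ)) < ⊤ := by
  rw [HsNorm_lt_top_iff, HsNormSq]
  have := integrable_rpow_neg_one_add_norm_sq (E := Edim d) (μ := volume) (r := 2 * (γ - s))
    (by simp; linarith)
  convert this.lintegral_lt_top using 4 with ξ
  rw [Complex.norm_real, Real.norm_of_nonneg (bracket_pos _ ξ).le, bracket, ← Real.rpow_mul_natCast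
    (by positivity), ← Real.rpow_add (by positivity)]
  congr 1; push_cast; ring

lemma HdotNorm_le_HsNorm {σ s : ℝ} {a : ℝ} {F G : Edim d → ℂ}
    (h : ∀ ξ, a * ‖ξ‖ ^ σ * ‖F ξ‖ ≤ bracket d s ξ * ‖G ξ‖) (ha : 0 ≤ a) :
    ENNReal.ofReal a * HdotNorm d σ F ≤ HsNorm d s G := by
  rw [HdotNorm_eq_eLpNorm, HsNorm_eq_eLpNorm]
  have : ENNReal.ofReal a = ‖a‖ₑ := by rw [Real.enorm_eq_ofReal ha]
  rw [this, ← eLpNorm_const_smul]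
  refine eLpNorm_mono fun ξ => ?_
  have := h ξ
  simp only [Pi.smul_apply, norm_smul, Real.norm_of_nonneg ha,
    Real.norm_of_nonneg (bracket_pos s ξ).le]
  rw [Real.norm_of_nonneg (by positivity)]
  linarith

lemma HsNorm_mono {s : ℝ} {F G : Edim d → ℂ} (h : ∀ ξ, ‖F ξ‖ ≤ ‖G ξ‖) :
    HsNorm d s F ≤ HsNorm d s G := by
  rw [HsNorm_eq_eLpNorm, HsNorm_eq_eLpNorm]
  refine eLpNorm_mono fun ξ => ?_
  rw [norm_smul, norm_smul]
  gcongr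
  exact h ξ

lemma HsNorm_const_mul {s : ℝ} {a : ℝ} (ha : 0 ≤ a) (F : Edim d → ℂ) :
    HsNorm d s (fun ξ => (a : ℂ) * F ξ) = ENNReal.ofReal a * HsNorm d s F := by
  rw [HsNorm_eq_eLpNorm, HsNorm_eq_eLpNorm, ← Real.enorm_eq_ofReal ha, ← eLpNorm_const_smul]
  congr 1
  ext ξ
  simp only [Pi.smul_apply, Complex.real_smul]
  ring

end Norms

section Kernel

/-- `x ↦ e^{-x/2}` decays faster than `⟨x⟩^{-2}`. -/
lemma exp_neg_half_le {x : ℝ} (hx : 0 ≤ x) : Real.exp (-x / 2) ≤ 8 * (1 + x ^ 2)⁻¹ := by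
  have h := Real.quadratic_le_exp_of_nonneg (x := x / 2) (by positivity)
  rw [neg_div, Real.exp_neg, ← div_eq_mul_inv, inv_eq_one_div,
    div_le_div_iff₀ (Real.exp_pos _) (by positivity)]
  nlinarith

lemma Psym_nonneg (t r : ℝ) : 0 ≤ Psym t r := (Real.exp_pos _).le

lemma Psym_le {t γ : ℝ} (ht : 0 < t) (ht1 : t ≤ 1) (hγ : 0 ≤ γ) (hγ2 : γ ≤ 2) {d : ℕ}
    (ξ : Edim d) : Psym t ‖ξ‖ ≤ 8 * t ^ (-γ) * bracket d (-γ) ξ := by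
  have h1 := exp_neg_half_le (x := ‖ξ‖ * t) (by positivity)
  have h2 : (1 + (‖ξ‖ * t) ^ 2)⁻¹ ≤ (1 + (‖ξ‖ * t) ^ 2) ^ (-γ / 2) := by
    rw [← Real.rpow_neg_one]
    exact Real.rpow_le_rpow_of_exponent_le (by nlinarith [sq_nonneg (‖ξ‖ * t)]) (by linarith)
  have h3 : (1 + (‖ξ‖ * t) ^ 2) ^ (-γ / 2) ≤ (t ^ 2 * (1 + ‖ξ‖ ^ 2)) ^ (-γ / 2) := by
    refine Real.rpow_le_rpow_of_nonpos (by positivity) ?_ (by linarith)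
    nlinarith
  rw [Real.mul_rpow (by positivity) (by positivity), ← Real.rpow_natCast t 2,
    ← Real.rpow_mul ht.le] at h3
  have h4 : ((2 : ℕ) : ℝ) * (-γ / 2) = -γ := by push_cast; ring
  rw [h4] at h3
  unfold Psym bracket
  linarith

lemma abs_V1sym_le {t r : ℝ} (ht : 0 ≤ t) (hr : 0 ≤ r) : |V1sym t r| ≤ t := by
  unfold V1sym
  rcases hr.eq_or_lt with rfl | hr
  · simpa using ht
  have h3 : 0 < √3 := by positivity
  rw [abs_div, abs_of_pos (show 0 < √3 / 2 * r by positivity), div_le_iff₀ (by positivity)]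
  calc _ ≤ |√3 / 2 * r * t| := Real.abs_sin_le_abs
    _ = _ := by rw [abs_of_nonneg (by positivity)]; ring

lemma abs_V0sym_le (t r : ℝ) : |V0sym t r| ≤ 2 := by
  unfold V0sym
  have h3 : 1 ≤ √3 := by rw [Real.one_le_sqrt]; norm_num
  have h4 : 1 / √3 ≤ 1 := by rw [div_le_one (by positivity)]; exact h3
  calc _ ≤ |Real.cos (√3 / 2 * r * t)| + |1 / √3 * Real.sin (√3 / 2 * r * t)| := abs_add_le _ _
    _ ≤ 1 + 1 * 1 := by
        rw [abs_mul, abs_of_pos (show 0 < 1 / √3 by positivity)]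
        gcongr
        · exact Real.abs_cos_le_one _
        · exact Real.abs_sin_le_one _
    _ = 2 := by norm_num

lemma abs_Wsym_le {t γ : ℝ} (ht : 0 < t) (ht1 : t ≤ 1) (hγ : 0 ≤ γ) (hγ2 : γ ≤ 2) {d : ℕ}
    (ξ : Edim d) : |Wsym t ‖ξ‖| ≤ 8 * t ^ (1 - γ) * bracket d (-γ) ξ := by
  unfold Wsym
  rw [abs_mul, abs_of_nonneg (Psym_nonneg _ _)]
  calc _ ≤ (8 * t ^ (-γ) * bracket d (-γ) ξ) * t := by
        gcongr
        · have := bracket_pos (-γ) ξ; positivity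
        · exact Psym_le ht ht1 hγ hγ2 ξ
        · exact abs_V1sym_le ht.le (norm_nonneg _)
    _ = _ := by
        rw [sub_eq_add_neg, Real.rpow_add ht, Real.rpow_one]; ring

lemma Wsym_zero (r : ℝ) : Wsym 0 r = 0 := by simp [Wsym, V1sym]

lemma Psym_le_one {t r : ℝ} (ht : 0 ≤ t) (hr : 0 ≤ r) : Psym t r ≤ 1 := by
  unfold Psym
  rw [Real.exp_le_one_iff]
  have := mul_nonneg hr ht
  linarith

lemma abs_Wsym_le_one {t r : ℝ} (ht : 0 ≤ t) (ht1 : t ≤ 1) (hr : 0 ≤ r) : |Wsym t r| ≤ 1 := by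
  unfold Wsym
  rw [abs_mul, abs_of_nonneg (Psym_nonneg _ _)]
  exact mul_le_one₀ (Psym_le_one ht hr) (abs_nonneg _) ((abs_V1sym_le ht hr).trans ht1)

lemma continuous_Wsym (r : ℝ) : Continuous fun t => Wsym t r := by
  unfold Wsym Psym V1sym; fun_prop

lemma measurable_Wsym : Measurable fun q : ℝ × ℝ => Wsym q.1 q.2 := by
  unfold Wsym Psym V1sym; fun_prop

end Kernel

section Continuity

variable {d : ℕ}

/-- Continuity of `t ↦ u t` in `H^s` on the set `S`. -/
def HsContinuousOn (d : ℕ) (s : ℝ) (S : Set ℝ) (u : ℝ → Edim d → ℂ) : Prop :=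
  ∀ t₀ ∈ S, Tendsto (fun t => HsNorm d s fun ξ => u t ξ - u t₀ ξ) (𝓝[S] t₀) (𝓝 0)

lemma hsContinuousOn_iff {s : ℝ} {S : Set ℝ} {u : ℝ → Edim d → ℂ} :
    HsContinuousOn d s S u ↔ ∀ t₀ ∈ S, ∀ ε : ℝ, 0 < ε → ∃ δ : ℝ, 0 < δ ∧
      ∀ t ∈ S, |t - t₀| < δ → HsNorm d s (fun ξ => u t ξ - u t₀ ξ) < ENNReal.ofReal ε := by
  refine forall₂_congr fun t₀ _ => ⟨fun h ε hε => ?_, fun h => ?_⟩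
  · have := h.eventually (gt_mem_nhds (ENNReal.ofReal_pos.2 hε))
    rw [eventually_nhdsWithin_iff, Metric.eventually_nhds_iff] at this
    obtain ⟨δ, hδ, h⟩ := this
    exact ⟨δ, hδ, fun t ht htd => h (by rwa [Real.dist_eq]) ht⟩
  · rw [ENNReal.tendsto_nhds_zero]
    intro ε hε
    obtain ⟨r, hr, hrε⟩ := ENNReal.lt_iff_exists_nnreal_btwn.1 hε
    obtain ⟨δ, hδ, h⟩ := h r (by simpa using hr)
    rw [eventually_nhdsWithin_iff, Metric.eventually_nhds_iff]
    exact ⟨δ, hδ, fun t htd ht => ((h t ht (by rwa [Real.dist_eq] at htd)).trans_le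
      (by simp)).le.trans hrε.le⟩

lemma hsContinuousOn_of_dominated {s : ℝ} {S : Set ℝ} {u : ℝ → Edim d → ℂ} {G : Edim d → ℂ}
    (hu : ∀ t ∈ S, Measurable (u t)) (hG : HsNorm d s G < ⊤)
    (hb : ∀ t ∈ S, ∀ ξ, ‖u t ξ‖ ≤ ‖G ξ‖) (hc : ∀ ξ, ContinuousOn (fun t => u t ξ) S) :
    HsContinuousOn d s S u := by
  intro t₀ ht₀
  have key : Tendsto (fun t => HsNormSq d s fun ξ => u t ξ - u t₀ ξ) (𝓝[S] t₀) (𝓝 0) := by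
    have h0 : (0 : ℝ≥0∞) = ∫⁻ _ : Edim d, 0 := by simp
    unfold HsNormSq
    rw [h0]
    refine tendsto_lintegral_filter_of_dominated_convergence
      (fun ξ => ENNReal.ofReal ((1 + ‖ξ‖ ^ 2) ^ s * ‖((2 : ℝ) : ℂ) * G ξ‖ ^ 2)) ?_ ?_ ?_ ?_
    · filter_upwards [self_mem_nhdsWithin] with t ht
      have := (hu t ht).sub (hu t₀ ht₀)
      fun_prop
    · filter_upwards [self_mem_nhdsWithin] with t ht
      refine Eventually.of_forall fun ξ => ?_
      gcongr
      rw [norm_mul, Complex.norm_real, Real.norm_of_nonneg (by norm_num)]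
      have := norm_sub_le (u t ξ) (u t₀ ξ)
      have := hb t ht ξ
      have := hb t₀ ht₀ ξ
      linarith
    · have : HsNorm d s (fun ξ => ((2 : ℝ) : ℂ) * G ξ) < ⊤ := by
        rw [HsNorm_const_mul (by norm_num)]
        exact ENNReal.mul_lt_top ENNReal.ofReal_lt_top hG
      exact (HsNorm_lt_top_iff.1 this).ne
    · refine Eventually.of_forall fun ξ => ?_
      have h1 := (hc ξ t₀ ht₀).tendsto
      have h2 : Tendsto (fun t => (1 + ‖ξ‖ ^ 2) ^ s * ‖u t ξ - u t₀ ξ‖ ^ 2) (𝓝[S] t₀)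
          (𝓝 ((1 + ‖ξ‖ ^ 2) ^ s * ‖u t₀ ξ - u t₀ ξ‖ ^ 2)) :=
        ((h1.sub_const _).norm.pow 2).const_mul _
      simpa using ENNReal.tendsto_ofReal h2
  have := ((ENNReal.continuous_rpow_const (y := 1 / 2)).tendsto 0).comp key
  rw [ENNReal.zero_rpow_of_pos (by norm_num)] at this
  exact this

lemma HsContinuousOn.sub {s : ℝ} {S : Set ℝ} {u v : ℝ → Edim d → ℂ}
    (hu : HsContinuousOn d s S u) (hv : HsContinuousOn d s S v)
    (hum : ∀ t ∈ S, Measurable (u t)) (hvm : ∀ t ∈ S, Measurable (v t)) :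
    HsContinuousOn d s S fun t ξ => u t ξ - v t ξ := by
  intro t₀ ht₀
  have h := (hu t₀ ht₀).add (hv t₀ ht₀)
  rw [add_zero] at h
  refine tendsto_of_tendsto_of_tendsto_of_le_of_le' tendsto_const_nhds h
    (Eventually.of_forall fun _ => zero_le) ?_
  filter_upwards [self_mem_nhdsWithin] with t ht
  refine le_trans (le_of_eq ?_) (HsNorm_sub_le ((hum t ht).sub (hum t₀ ht₀))
    ((hvm t ht).sub (hvm t₀ ht₀)))
  congr 1
  ext ξ
  ring

end Continuity

section SolutionNorm

variable {d : ℕ}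

/-- The `X(T)` norm with a general exponent `σ` for the smoothing component. -/
def smoothingNorm (d : ℕ) (σ s T : ℝ) (u : ℝ → Edim d → ℂ) : ℝ≥0∞ :=
  (⨆ t ∈ Set.Icc (0 : ℝ) T, HsNorm d s (u t)) +
    ⨆ t ∈ Set.Ioo (0 : ℝ) T, ENNReal.ofReal (t ^ (-s + σ)) * HdotNorm d σ (u t)

variable {σ s T : ℝ} {u v : ℝ → Edim d → ℂ}

lemma HsNorm_le_smoothingNorm (u : ℝ → Edim d → ℂ) {t : ℝ} (ht : t ∈ Icc 0 T) :
    HsNorm d s (u t) ≤ smoothingNorm d σ s T u :=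
  (le_iSup₂ (f := fun t (_ : t ∈ Icc 0 T) => HsNorm d s (u t)) t ht).trans le_self_add

lemma HdotNorm_le_smoothingNorm (u : ℝ → Edim d → ℂ) {t : ℝ} (ht : t ∈ Ioo 0 T) :
    ENNReal.ofReal (t ^ (-s + σ)) * HdotNorm d σ (u t) ≤ smoothingNorm d σ s T u :=
  (le_iSup₂ (f := fun t (_ : t ∈ Ioo 0 T) =>
    ENNReal.ofReal (t ^ (-s + σ)) * HdotNorm d σ (u t)) t ht).trans le_add_self

lemma smoothingNorm_le {a b : ℝ≥0∞} (h1 : ∀ t ∈ Icc 0 T, HsNorm d s (u t) ≤ a)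
    (h2 : ∀ t ∈ Ioo 0 T, ENNReal.ofReal (t ^ (-s + σ)) * HdotNorm d σ (u t) ≤ b) :
    smoothingNorm d σ s T u ≤ a + b :=
  add_le_add (iSup₂_le h1) (iSup₂_le h2)

lemma smoothingNorm_add_le (hu : ∀ t ∈ Icc 0 T, Measurable (u t))
    (hv : ∀ t ∈ Icc 0 T, Measurable (v t)) :
    smoothingNorm d σ s T (fun t ξ => u t ξ + v t ξ) ≤
      smoothingNorm d σ s T u + smoothingNorm d σ s T v := by
  calc _ ≤ ((⨆ t ∈ Icc 0 T, HsNorm d s (u t)) + ⨆ t ∈ Icc 0 T, HsNorm d s (v t)) +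
        ((⨆ t ∈ Ioo 0 T, ENNReal.ofReal (t ^ (-s + σ)) * HdotNorm d σ (u t)) +
          ⨆ t ∈ Ioo 0 T, ENNReal.ofReal (t ^ (-s + σ)) * HdotNorm d σ (v t)) := by
        refine smoothingNorm_le (fun t ht => (HsNorm_add_le (hu t ht) (hv t ht)).trans ?_)
          fun t ht => ?_
        · exact add_le_add (le_iSup₂ (f := fun t (_ : t ∈ Icc 0 T) => HsNorm d s (u t)) t ht)
            (le_iSup₂ (f := fun t (_ : t ∈ Icc 0 T) => HsNorm d s (v t)) t ht)
        · refine (mul_le_mul_right (HdotNorm_add_le (hu t (Ioo_subset_Icc_self ht))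
            (hv t (Ioo_subset_Icc_self ht))) _).trans ?_
          rw [mul_add]
          exact add_le_add (le_iSup₂ (f := fun t (_ : t ∈ Ioo 0 T) =>
              ENNReal.ofReal (t ^ (-s + σ)) * HdotNorm d σ (u t)) t ht)
            (le_iSup₂ (f := fun t (_ : t ∈ Ioo 0 T) =>
              ENNReal.ofReal (t ^ (-s + σ)) * HdotNorm d σ (v t)) t ht)
    _ = _ := by unfold smoothingNorm; exact add_add_add_comm _ _ _ _

lemma smoothingNorm_congr_ae (h : ∀ t ∈ Icc 0 T, u t =ᵐ[volume] v t) :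
    smoothingNorm d σ s T u = smoothingNorm d σ s T v := by
  unfold smoothingNorm
  congr 1
  · exact iSup_congr fun t => iSup_congr fun ht => HsNorm_congr_ae (h t ht)
  · exact iSup_congr fun t => iSup_congr fun ht => by
      rw [HdotNorm_congr_ae (h t (Ioo_subset_Icc_self ht))]

end SolutionNorm

section LinearFlow

variable {d : ℕ}

/-- A pointwise majorant of the linear flow. -/
def flowMajorant (d : ℕ) (F₀ F₁ : Edim d → ℂ) (ξ : Edim d) : ℂ :=
  ((16 * (‖F₀ ξ‖ + bracket d (-1) ξ * ‖F₁ ξ‖) : ℝ) : ℂ)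

lemma norm_flowMajorant (F₀ F₁ : Edim d → ℂ) (ξ : Edim d) :
    ‖flowMajorant d F₀ F₁ ξ‖ = 16 * (‖F₀ ξ‖ + bracket d (-1) ξ * ‖F₁ ξ‖) := by
  have := bracket_pos (-1) ξ
  rw [flowMajorant, Complex.norm_real, Real.norm_of_nonneg (by positivity)]

lemma HsNorm_flowMajorant_le {s : ℝ} {F₀ F₁ : Edim d → ℂ} (h₀ : Measurable F₀)
    (h₁ : Measurable F₁) : HsNorm d s (flowMajorant d F₀ F₁) ≤ 32 * pairHsNorm d s F₀ F₁ := by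
  have hb := measurable_bracket (d := d) (-1)
  have e : flowMajorant d F₀ F₁ = fun ξ => ((16 : ℝ) : ℂ) * ((‖F₀ ξ‖ : ℂ) +
      bracket d (-1) ξ • (‖F₁ ξ‖ : ℂ)) := by
    ext ξ; simp [flowMajorant]
  rw [e, HsNorm_const_mul (by norm_num)]
  have h2 : HsNorm d s (fun ξ => (‖F₀ ξ‖ : ℂ)) ≤ pairHsNorm d s F₀ F₁ :=
    (HsNorm_mono (fun ξ => by simp)).trans (HsNorm_le_pairHsNorm s F₀ F₁)
  have h3 : HsNorm d s (fun ξ => bracket d (-1) ξ • (‖F₁ ξ‖ : ℂ)) ≤ pairHsNorm d s F₀ F₁ := by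
    rw [bracket_mul_HsNorm]
    exact (HsNorm_mono (fun ξ => by simp)).trans (HsNorm_le_pairHsNorm' s F₀ F₁)
  calc _ ≤ ENNReal.ofReal 16 * (pairHsNorm d s F₀ F₁ + pairHsNorm d s F₀ F₁) := by
        gcongr
        refine (HsNorm_add_le (by fun_prop) ?_).trans (add_le_add h2 h3)
        exact hb.smul (by fun_prop)
    _ = _ := by
        rw [← two_mul, ← mul_assoc]; norm_num

lemma measurable_Vflow {F₀ F₁ : Edim d → ℂ} (h₀ : Measurable F₀) (h₁ : Measurable F₁) (t : ℝ) :
    Measurable (Vflow d F₀ F₁ t) := by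
  unfold Vflow Psym V0sym V1sym; fun_prop

lemma continuous_Vflow (F₀ F₁ : Edim d → ℂ) (ξ : Edim d) :
    Continuous fun t => Vflow d F₀ F₁ t ξ := by
  unfold Vflow Psym V0sym V1sym; fun_prop

lemma norm_Vflow_le_aux (F₀ F₁ : Edim d → ℂ) (t : ℝ) (ξ : Edim d) :
    ‖Vflow d F₀ F₁ t ξ‖ ≤ Psym t ‖ξ‖ * 2 * ‖F₀ ξ‖ + |Wsym t ‖ξ‖| * ‖F₁ ξ‖ := by
  unfold Vflow
  refine (norm_add_le _ _).trans ?_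
  rw [norm_mul, norm_mul, Complex.norm_real, Complex.norm_real, Real.norm_eq_abs, abs_mul,
    abs_of_nonneg (Psym_nonneg _ _), Real.norm_eq_abs, Wsym]
  have := Psym_nonneg t ‖ξ‖
  gcongr
  exact abs_V0sym_le _ _

lemma norm_Vflow_le (F₀ F₁ : Edim d → ℂ) {t : ℝ} (ht : 0 ≤ t) (ht1 : t ≤ 1) (ξ : Edim d) :
    ‖Vflow d F₀ F₁ t ξ‖ ≤ ‖flowMajorant d F₀ F₁ ξ‖ := by
  have hb := bracket_pos (-1) ξ
  have hW : |Wsym t ‖ξ‖| ≤ 8 * bracket d (-1) ξ := by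
    rcases ht.eq_or_lt with rfl | ht
    · rw [Wsym_zero]; simp [hb.le]
    · simpa using abs_Wsym_le ht ht1 (γ := 1) (by norm_num) (by norm_num) ξ
  have hP := Psym_le_one ht (norm_nonneg ξ)
  rw [norm_flowMajorant]
  refine (norm_Vflow_le_aux F₀ F₁ t ξ).trans ?_
  have h1 := mul_le_mul_of_nonneg_right hP (norm_nonneg (F₀ ξ))
  have h2 := mul_le_mul_of_nonneg_right hW (norm_nonneg (F₁ ξ))
  have h3 : 0 ≤ bracket d (-1) ξ * ‖F₁ ξ‖ := by positivity
  have := norm_nonneg (F₀ ξ)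
  linarith

lemma smoothing_Vflow_le {σ s : ℝ} (hσ : 0 ≤ σ) (hs : s ≤ 0) (hσs : σ - s ≤ 1)
    (F₀ F₁ : Edim d → ℂ) {t : ℝ} (ht : 0 < t) (ht1 : t ≤ 1) (ξ : Edim d) :
    t ^ (-s + σ) * ‖ξ‖ ^ σ * ‖Vflow d F₀ F₁ t ξ‖ ≤
      bracket d s ξ * ‖flowMajorant d F₀ F₁ ξ‖ := by
  have hb := bracket_pos s ξ
  have hP := Psym_le ht ht1 (γ := σ - s) (by linarith) (by linarith) ξ
  have hW := abs_Wsym_le ht ht1 (γ := 1 + (σ - s)) (by linarith) (by linarith) ξ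
  have e1 : bracket d (-(σ - s)) ξ * bracket d σ ξ = bracket d s ξ := by
    rw [← bracket_add]; congr 1; ring
  have e2 : bracket d (-(1 + (σ - s))) ξ = bracket d (-(σ - s)) ξ * bracket d (-1) ξ := by
    rw [← bracket_add]; congr 1; ring
  have e3 : t ^ (-s + σ) * t ^ (-(σ - s)) = 1 := by
    rw [← Real.rpow_add ht]; ring_nf; exact Real.rpow_zero t
  have e4 : (1 : ℝ) - (1 + (σ - s)) = -(σ - s) := by ring
  rw [norm_flowMajorant]
  rw [e2, e4] at hW
  have hp1 := bracket_pos (-(σ - s)) ξ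
  have hp2 := bracket_pos (-1) ξ
  have hp3 := bracket_pos σ ξ
  have hp4 := Psym_nonneg t ‖ξ‖
  calc t ^ (-s + σ) * ‖ξ‖ ^ σ * ‖Vflow d F₀ F₁ t ξ‖
      ≤ t ^ (-s + σ) * bracket d σ ξ * ((8 * t ^ (-(σ - s)) * bracket d (-(σ - s)) ξ) * 2 * ‖F₀ ξ‖
        + (8 * t ^ (-(σ - s)) * (bracket d (-(σ - s)) ξ * bracket d (-1) ξ)) * ‖F₁ ξ‖) := by
        gcongr
        · exact norm_rpow_le_bracket hσ ξ
        · refine (norm_Vflow_le_aux F₀ F₁ t ξ).trans ?_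
          gcongr
    _ = (t ^ (-s + σ) * t ^ (-(σ - s))) * (bracket d (-(σ - s)) ξ * bracket d σ ξ) *
        (16 * ‖F₀ ξ‖ + 8 * (bracket d (-1) ξ * ‖F₁ ξ‖)) := by ring
    _ ≤ _ := by
        rw [e1, e3, one_mul]
        gcongr
        have : 0 ≤ bracket d (-1) ξ * ‖F₁ ξ‖ := by positivity
        linarith

lemma smoothingNorm_Vflow_le {σ s T : ℝ} (hσ : 0 ≤ σ) (hs : s ≤ 0) (hσs : σ - s ≤ 1)
    (hT1 : T ≤ 1) {F₀ F₁ : Edim d → ℂ} (h₀ : Measurable F₀) (h₁ : Measurable F₁) :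
    smoothingNorm d σ s T (Vflow d F₀ F₁) ≤ 64 * pairHsNorm d s F₀ F₁ := by
  have h := HsNorm_flowMajorant_le (s := s) h₀ h₁
  calc _ ≤ 32 * pairHsNorm d s F₀ F₁ + 32 * pairHsNorm d s F₀ F₁ := by
        refine smoothingNorm_le (fun t ht => ?_) fun t ht => ?_
        · exact (HsNorm_mono (norm_Vflow_le F₀ F₁ ht.1 (ht.2.trans hT1))).trans h
        · exact (HdotNorm_le_HsNorm (smoothing_Vflow_le hσ hs hσs F₀ F₁ ht.1 (ht.2.le.trans hT1))
            (by have := ht.1; positivity)).trans h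
    _ = _ := by rw [← add_mul]; norm_num

lemma hsContinuousOn_Vflow {s T : ℝ} (hT1 : T ≤ 1) {F₀ F₁ : Edim d → ℂ} (h₀ : Measurable F₀)
    (h₁ : Measurable F₁) (hF : pairHsNorm d s F₀ F₁ < ⊤) :
    HsContinuousOn d s (Icc 0 T) (Vflow d F₀ F₁) :=
  hsContinuousOn_of_dominated (fun t _ => measurable_Vflow h₀ h₁ t)
    ((HsNorm_flowMajorant_le h₀ h₁).trans_lt (ENNReal.mul_lt_top (by norm_num) hF))
    (fun _ ht => norm_Vflow_le F₀ F₁ ht.1 (ht.2.trans hT1))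
    fun ξ => (continuous_Vflow F₀ F₁ ξ).continuousOn

end LinearFlow

section Convolution

variable {d : ℕ}

/-- The `L²` norm of an extended nonnegative function. -/
def lnorm (d : ℕ) (f : Edim d → ℝ≥0∞) : ℝ≥0∞ := (∫⁻ ξ, f ξ ^ (2 : ℝ)) ^ (1 / 2 : ℝ)

lemma HdotNorm_eq_lnorm (σ : ℝ) (F : Edim d → ℂ) :
    HdotNorm d σ F = lnorm d fun ξ => ENNReal.ofReal (‖ξ‖ ^ σ) * ‖F ξ‖ₑ := by
  rw [HdotNorm_eq_eLpNorm, eLpNorm_eq_lintegral_rpow_enorm_toReal (by norm_num) (by norm_num)]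
  simp only [ENNReal.toReal_ofNat, lnorm]
  congr 1
  refine lintegral_congr fun ξ => ?_
  rw [enorm_smul, Real.enorm_eq_ofReal (by positivity)]

lemma HdotNorm_zero_eq_lnorm (F : Edim d → ℂ) : HdotNorm d 0 F = lnorm d fun ξ => ‖F ξ‖ₑ := by
  simp [HdotNorm_eq_lnorm]

/-- Convolution of extended nonnegative functions. -/
def econv (d : ℕ) (f g : Edim d → ℝ≥0∞) (ξ : Edim d) : ℝ≥0∞ := ∫⁻ η, f (ξ - η) * g η

lemma econv_le {f g : Edim d → ℝ≥0∞} (hf : Measurable f) (hg : Measurable g) (ξ : Edim d) :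
    econv d f g ξ ≤ lnorm d f * lnorm d g := by
  have h := ENNReal.lintegral_mul_le_Lp_mul_Lq (volume : Measure (Edim d))
    Real.HolderConjugate.two_two (f := fun η => f (ξ - η)) (g := g) (by fun_prop) hg.aemeasurable
  rw [lintegral_sub_left_eq_self (fun η => f η ^ (2 : ℝ)) ξ] at h
  exact h

lemma enorm_conv_le (f g : Edim d → ℂ) (ξ : Edim d) :
    ‖conv d f g ξ‖ₑ ≤ econv d (fun η => ‖f η‖ₑ) (fun η => ‖g η‖ₑ) ξ :=
  (enorm_integral_le_lintegral_enorm _).trans_eq (by simp only [enorm_mul, econv])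

lemma measurable_conv {f g : Edim d → ℂ} (hf : Measurable f) (hg : Measurable g) :
    Measurable (conv d f g) := by
  have : Measurable fun z : Edim d × Edim d => f (z.1 - z.2) * g z.2 := by fun_prop
  exact this.stronglyMeasurable.integral_prod_right.measurable

lemma integrable_conv {f g : Edim d → ℂ} (hf : Measurable f) (hg : Measurable g) {ξ : Edim d}
    (h : econv d (fun η => ‖f η‖ₑ) (fun η => ‖g η‖ₑ) ξ < ⊤) :
    Integrable fun η => f (ξ - η) * g η := by
  refine ⟨by fun_prop, ?_⟩
  simp only [HasFiniteIntegral, enorm_mul]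
  exact h

lemma enorm_conv_sub_conv_le {f f' g g' : Edim d → ℂ} (hf : Measurable f) (hg : Measurable g)
    (hf' : Measurable f') (hg' : Measurable g') {ξ : Edim d}
    (h : econv d (fun η => ‖f η‖ₑ) (fun η => ‖g η‖ₑ) ξ < ⊤)
    (h' : econv d (fun η => ‖f' η‖ₑ) (fun η => ‖g' η‖ₑ) ξ < ⊤) :
    ‖conv d f g ξ - conv d f' g' ξ‖ₑ ≤
      econv d (fun η => ‖f η - f' η‖ₑ) (fun η => ‖g η‖ₑ) ξ +
        econv d (fun η => ‖f' η‖ₑ) (fun η => ‖g η - g' η‖ₑ) ξ := by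
  unfold conv econv
  rw [← integral_sub (integrable_conv hf hg h) (integrable_conv hf' hg' h'),
    ← lintegral_add_left (by fun_prop)]
  refine (enorm_integral_le_lintegral_enorm _).trans (lintegral_mono fun η => ?_)
  simp only [← enorm_mul]
  refine le_trans (le_of_eq ?_) (enorm_add_le _ _)
  congr 1
  ring

lemma econv_mono {f f' g g' : Edim d → ℝ≥0∞} (hf : f ≤ f') (hg : g ≤ g') (ξ : Edim d) :
    econv d f g ξ ≤ econv d f' g' ξ :=
  lintegral_mono fun _ => mul_le_mul' (hf _) (hg _)

lemma convIter_congr_ae {f g : Edim d → ℂ} (h : f =ᵐ[volume] g) (n : ℕ) :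
    convIter d f (n + 1) = convIter d g (n + 1) := by
  have key : ∀ n, convIter d f n =ᵐ[volume] convIter d g n →
      convIter d f (n + 1) = convIter d g (n + 1) := by
    intro n hn
    ext ξ
    refine integral_congr_ae ?_
    have := (quasiMeasurePreserving_sub_left (volume : Measure (Edim d)) ξ).ae_eq_comp hn
    filter_upwards [this, h] with η h1 h2
    simp only [Function.comp_apply] at h1
    simp only [h1, h2]
  induction n with
  | zero => exact key 0 h
  | succ n ih => exact key (n + 1) (by rw [ih])

lemma measurable_convIter {u : ℝ → Edim d → ℂ} (hu : Measurable fun z : ℝ × Edim d => u z.1 z.2)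
    (n : ℕ) : Measurable fun z : ℝ × Edim d => convIter d (u z.1) n z.2 := by
  induction n with
  | zero => exact hu
  | succ n ih =>
    have : Measurable fun z : (ℝ × Edim d) × Edim d =>
        convIter d (u z.1.1) n (z.1.2 - z.2) * u z.1.1 z.2 := by
      have h1 := ih.comp (show Measurable fun z : (ℝ × Edim d) × Edim d =>
        (z.1.1, z.1.2 - z.2) by fun_prop)
      have h2 := hu.comp (show Measurable fun z : (ℝ × Edim d) × Edim d => (z.1.1, z.2) by fun_prop)
      exact h1.mul h2
    exact this.stronglyMeasurable.integral_prod_right.measurable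

lemma convIter_zero_fun (n : ℕ) : convIter d (fun _ => 0) n = fun _ => 0 := by
  cases n with
  | zero => rfl
  | succ n => ext ξ; simp [convIter, conv]

end Convolution

section Trilinear

/-- The integral of `Φ` over the plane `a + b + c = ξ`. -/
def planeIntegral (ξ : Edim 1) (Φ : Edim 1 → Edim 1 → Edim 1 → ℝ≥0∞) : ℝ≥0∞ :=
  ∫⁻ b, ∫⁻ a, Φ a b (ξ - a - b)

lemma planeIntegral_swap₁₃ (ξ : Edim 1) (Φ : Edim 1 → Edim 1 → Edim 1 → ℝ≥0∞) :
    planeIntegral ξ (fun a b c => Φ c b a) = planeIntegral ξ Φ := by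
  unfold planeIntegral
  refine lintegral_congr fun b => ?_
  rw [← lintegral_sub_left_eq_self (fun a => Φ a b (ξ - a - b)) (ξ - b)]
  refine lintegral_congr fun a => ?_
  congr 1 <;> abel

lemma planeIntegral_swap₁₂ (ξ : Edim 1) {Φ : Edim 1 → Edim 1 → Edim 1 → ℝ≥0∞}
    (hΦ : Measurable fun z : Edim 1 × Edim 1 × Edim 1 => Φ z.1 z.2.1 z.2.2) :
    planeIntegral ξ (fun a b c => Φ b a c) = planeIntegral ξ Φ := by
  unfold planeIntegral
  rw [lintegral_lintegral_swap]
  · simp only [sub_right_comm ξ]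
  · exact (hΦ.comp (show Measurable fun z : Edim 1 × Edim 1 => (z.1, z.2, ξ - z.2 - z.1) by
      fun_prop)).aemeasurable

lemma lintegral_rpow_closedBall_le : ∃ κ : ℝ≥0, ∀ r : ℝ, 0 < r →
    ∫⁻ a in Metric.closedBall (0 : Edim 1) r, ENNReal.ofReal (‖a‖ ^ (-(1 / 3) : ℝ)) ≤
      κ * ENNReal.ofReal (r ^ (2 / 3 : ℝ)) := by
  set m := (volume : Measure (Edim 1)).real (Metric.ball 0 1)
  refine ⟨(m * (3 / 2)).toNNReal, fun r hr => ?_⟩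
  have hi : IntegrableOn (fun a : Edim 1 => ‖a‖ ^ (-(1 / 3) : ℝ)) (Metric.ball 0 r) volume := by
    rw [integrableOn_fun_norm_addHaar volume (f := fun x : ℝ => x ^ (-(1 / 3) : ℝ))]
    have := (intervalIntegral.intervalIntegrable_rpow' (a := 0) (b := r) (r := -(1 / 3))
      (by norm_num)).1
    simpa using this.mono_set Ioo_subset_Ioc_self
  have e : ∫ a in Metric.ball (0 : Edim 1) r, ‖a‖ ^ (-(1 / 3) : ℝ) =
      m * (3 / 2) * r ^ (2 / 3 : ℝ) := by
    have h := integral_fun_norm_addHaar (volume : Measure (Edim 1))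
      ((Iio r).indicator fun x : ℝ => x ^ (-(1 / 3) : ℝ))
    have e1 : (fun x : Edim 1 => (Iio r).indicator (fun x : ℝ => x ^ (-(1 / 3) : ℝ)) ‖x‖) =
        (Metric.ball (0 : Edim 1) r).indicator fun a => ‖a‖ ^ (-(1 / 3) : ℝ) := by
      ext x; simp [indicator]
    rw [e1, integral_indicator Metric.isOpen_ball.measurableSet] at h
    rw [h]
    simp only [finrank_euclideanSpace, Fintype.card_fin, tsub_self, pow_zero, smul_eq_mul, one_mul,
      one_smul]
    rw [setIntegral_indicator measurableSet_Iio, Ioi_inter_Iio, ← integral_Ioc_eq_integral_Ioo,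
      ← intervalIntegral.integral_of_le hr.le, integral_rpow (Or.inl (by norm_num)),
      Real.zero_rpow (by norm_num)]
    norm_num
    ring
  have hb : Metric.ball (0 : Edim 1) r =ᵐ[volume] Metric.closedBall 0 r := by
    rw [← Metric.ball_union_sphere]
    exact (union_ae_eq_left_of_ae_eq_empty
      (ae_eq_empty.2 (Measure.addHaar_sphere_of_ne_zero _ _ hr.ne'))).symm
  rw [← Measure.restrict_congr_set hb,
    ← ofReal_integral_eq_lintegral_ofReal hi (Eventually.of_forall fun a => by positivity), e,
    ENNReal.ofReal_mul (by positivity), ENNReal.ofReal]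

/-- The contribution of the region `‖a‖ ≤ ‖b‖ ≤ ‖c‖`. -/
def ordered (f g h : Edim 1 → ℝ≥0∞) (a b c : Edim 1) : ℝ≥0∞ :=
  {z : Edim 1 × Edim 1 × Edim 1 | ‖z.1‖ ≤ ‖z.2.1‖ ∧ ‖z.2.1‖ ≤ ‖z.2.2‖}.indicator
    (fun z => f z.1 * g z.2.1 * h z.2.2) (a, b, c)

lemma measurable_ordered {f g h : Edim 1 → ℝ≥0∞} (hf : Measurable f) (hg : Measurable g)
    (hh : Measurable h) :
    Measurable fun z : Edim 1 × Edim 1 × Edim 1 => ordered f g h z.1 z.2.1 z.2.2 := by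
  unfold ordered
  refine Measurable.indicator (by fun_prop) (MeasurableSet.inter ?_ ?_)
  · exact measurableSet_le (f := fun z : Edim 1 × Edim 1 × Edim 1 => ‖z.1‖)
      (g := fun z => ‖z.2.1‖) (by fun_prop) (by fun_prop)
  · exact measurableSet_le (f := fun z : Edim 1 × Edim 1 × Edim 1 => ‖z.2.1‖)
      (g := fun z => ‖z.2.2‖) (by fun_prop) (by fun_prop)

/-- `|ξ|^{1/6} f(ξ)`. -/
def sixth (f : Edim 1 → ℝ≥0∞) (ξ : Edim 1) : ℝ≥0∞ := ENNReal.ofReal (‖ξ‖ ^ (1 / 6 : ℝ)) * f ξ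

lemma measurable_sixth {f : Edim 1 → ℝ≥0∞} (hf : Measurable f) : Measurable (sixth f) := by
  unfold sixth; fun_prop

/-- The kernel `|a|^{-1/6} |b|^{-1/3}` on `‖a‖ ≤ ‖b‖`. -/
def orderedKernel (a b : Edim 1) : ℝ≥0∞ :=
  {z : Edim 1 × Edim 1 | ‖z.1‖ ≤ ‖z.2‖}.indicator
    (fun z => ENNReal.ofReal (‖z.1‖ ^ (-(1 / 6) : ℝ) * ‖z.2‖ ^ (-(1 / 3) : ℝ))) (a, b)

lemma measurable_orderedKernel :
    Measurable fun z : Edim 1 × Edim 1 => orderedKernel z.2 z.1 := by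
  unfold orderedKernel
  have h : Measurable ({z : Edim 1 × Edim 1 | ‖z.1‖ ≤ ‖z.2‖}.indicator
    (fun z => ENNReal.ofReal (‖z.1‖ ^ (-(1 / 6) : ℝ) * ‖z.2‖ ^ (-(1 / 3) : ℝ)))) :=
    Measurable.indicator (by fun_prop) (measurableSet_le (by fun_prop) (by fun_prop))
  exact h.comp measurable_swap

lemma measurable_orderedKernel_left (b : Edim 1) : Measurable fun a => orderedKernel a b := by
  have h : Measurable fun a : Edim 1 => (b, a) := measurable_prodMk_left
  have h' := measurable_orderedKernel.comp h
  simpa only [Function.comp_def] using h'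

lemma lintegral_orderedKernel_sq_le : ∃ κ : ℝ≥0, ∀ b : Edim 1, b ≠ 0 →
    ∫⁻ a, orderedKernel a b ^ (2 : ℝ) ≤ κ := by
  obtain ⟨κ, hκ⟩ := lintegral_rpow_closedBall_le
  refine ⟨κ, fun b hb => ?_⟩
  have hb' : 0 < ‖b‖ := norm_pos_iff.2 hb
  calc ∫⁻ a, orderedKernel a b ^ (2 : ℝ)
      = ∫⁻ a in Metric.closedBall (0 : Edim 1) ‖b‖,
          ENNReal.ofReal (‖b‖ ^ (-(2 / 3) : ℝ)) * ENNReal.ofReal (‖a‖ ^ (-(1 / 3) : ℝ)) := by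
        rw [← lintegral_indicator Metric.isClosed_closedBall.measurableSet]
        refine lintegral_congr fun a => ?_
        unfold orderedKernel
        by_cases h : ‖a‖ ≤ ‖b‖
        · rw [indicator_of_mem (by simpa using h), indicator_of_mem (by simpa using h),
            ENNReal.ofReal_rpow_of_nonneg (by positivity) (by norm_num),
            ← ENNReal.ofReal_mul (by positivity), Real.mul_rpow (by positivity) (by positivity),
            ← Real.rpow_mul (by positivity), ← Real.rpow_mul (by positivity), mul_comm]
          norm_num
        · rw [indicator_of_notMem (by simpa using h), indicator_of_notMem (by simpa using h)]
          simp
    _ ≤ ENNReal.ofReal (‖b‖ ^ (-(2 / 3) : ℝ)) * (κ * ENNReal.ofReal (‖b‖ ^ (2 / 3 : ℝ))) := by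
        rw [lintegral_const_mul _ (by fun_prop)]
        gcongr
        exact hκ _ hb'
    _ = κ := by
        rw [mul_left_comm, ← ENNReal.ofReal_mul (by positivity), ← Real.rpow_add hb']
        norm_num

lemma ordered_le (f g h : Edim 1 → ℝ≥0∞) {a : Edim 1} (ha : a ≠ 0) (b c : Edim 1) :
    ordered f g h a b c ≤ (sixth f a * sixth h c) * (sixth g b * orderedKernel a b) := by
  unfold ordered
  refine indicator_le' (s := {z : Edim 1 × Edim 1 × Edim 1 | ‖z.1‖ ≤ ‖z.2.1‖ ∧ ‖z.2.1‖ ≤ ‖z.2.2‖})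
    (f := fun z => f z.1 * g z.2.1 * h z.2.2)
    (g := fun z => if z.1 = 0 then ⊤ else
      (sixth f z.1 * sixth h z.2.2) * (sixth g z.2.1 * orderedKernel z.1 z.2.1)) ?_ ?_ (a, b, c)
    |>.trans_eq (by simp [ha])
  · rintro ⟨a, b, c⟩ ⟨hab, hbc⟩
    simp only at hab hbc
    by_cases ha : a = 0
    · simp [ha]
    have ha' : 0 < ‖a‖ := norm_pos_iff.2 ha
    have hb' : 0 < ‖b‖ := ha'.trans_le hab
    have hc' : 0 < ‖c‖ := hb'.trans_le hbc
    have hk : orderedKernel a b = ENNReal.ofReal (‖a‖ ^ (-(1 / 6) : ℝ) * ‖b‖ ^ (-(1 / 3) : ℝ)) :=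
      indicator_of_mem (s := {z : Edim 1 × Edim 1 | ‖z.1‖ ≤ ‖z.2‖}) (a := (a, b)) hab _
    simp only [ha, if_false, hk, sixth]
    have h1 : (1 : ℝ≥0∞) ≤ ENNReal.ofReal (‖a‖ ^ (1 / 6 : ℝ)) * ENNReal.ofReal (‖c‖ ^ (1 / 6 : ℝ)) *
        (ENNReal.ofReal (‖b‖ ^ (1 / 6 : ℝ)) *
          ENNReal.ofReal (‖a‖ ^ (-(1 / 6) : ℝ) * ‖b‖ ^ (-(1 / 3) : ℝ))) := by
      rw [← ENNReal.ofReal_mul (by positivity), ← ENNReal.ofReal_mul (by positivity),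
        ← ENNReal.ofReal_mul (by positivity), ENNReal.one_le_ofReal]
      have e1 : ‖a‖ ^ (1 / 6 : ℝ) * ‖a‖ ^ (-(1 / 6) : ℝ) = 1 := by
        rw [← Real.rpow_add ha']; norm_num
      have e2 : ‖b‖ ^ (1 / 6 : ℝ) * ‖b‖ ^ (-(1 / 3) : ℝ) * ‖b‖ ^ (1 / 6 : ℝ) = 1 := by
        rw [← Real.rpow_add hb', ← Real.rpow_add hb']; norm_num
      calc (1 : ℝ) = (‖a‖ ^ (1 / 6 : ℝ) * ‖a‖ ^ (-(1 / 6) : ℝ)) *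
            (‖b‖ ^ (1 / 6 : ℝ) * ‖b‖ ^ (-(1 / 3) : ℝ) * ‖b‖ ^ (1 / 6 : ℝ)) := by rw [e1, e2]; norm_num
        _ ≤ (‖a‖ ^ (1 / 6 : ℝ) * ‖a‖ ^ (-(1 / 6) : ℝ)) *
            (‖b‖ ^ (1 / 6 : ℝ) * ‖b‖ ^ (-(1 / 3) : ℝ) * ‖c‖ ^ (1 / 6 : ℝ)) := by gcongr
        _ = _ := by ring
    calc f a * g b * h c = 1 * (f a * g b * h c) := (one_mul _).symm
      _ ≤ _ := mul_le_mul_left h1 _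
      _ = _ := by ring
  · intros; exact zero_le

lemma planeIntegral_ordered_le : ∃ κ : ℝ≥0, ∀ f g h : Edim 1 → ℝ≥0∞, Measurable f →
    Measurable g → Measurable h → ∀ ξ, planeIntegral ξ (ordered f g h) ≤
      κ * (lnorm 1 (sixth f) * lnorm 1 (sixth g) * lnorm 1 (sixth h)) := by
  obtain ⟨κ, hκ⟩ := lintegral_orderedKernel_sq_le
  refine ⟨κ ^ (1 / 2 : ℝ), fun f g h hf hg hh ξ => ?_⟩
  have hf' := measurable_sixth hf
  have hg' := measurable_sixth hg
  have hh' := measurable_sixth hh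
  have hk := measurable_orderedKernel
  set P : Edim 1 × Edim 1 → ℝ≥0∞ := fun z => sixth f z.2 * sixth h (ξ - z.2 - z.1)
  set Q : Edim 1 × Edim 1 → ℝ≥0∞ := fun z => sixth g z.1 * orderedKernel z.2 z.1
  have hP : Measurable P := by fun_prop
  have hQ : Measurable Q := by fun_prop
  have hne : ∀ᵐ a : Edim 1, a ≠ 0 := by simp [ae_iff]
  have e1 : planeIntegral ξ (ordered f g h) ≤ ∫⁻ z, (P * Q) z ∂(volume.prod volume) := by
    rw [lintegral_prod _ (hP.mul hQ).aemeasurable]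
    refine lintegral_mono fun b => lintegral_mono_ae ?_
    filter_upwards [hne] with a ha
    exact ordered_le f g h ha b _
  have e2 : ∫⁻ z, P z ^ (2 : ℝ) ∂(volume.prod volume) =
      (∫⁻ a, sixth f a ^ (2 : ℝ)) * ∫⁻ c, sixth h c ^ (2 : ℝ) := by
    rw [lintegral_prod_symm _ (by fun_prop), ← lintegral_mul_const _ (by fun_prop)]
    refine lintegral_congr fun a => ?_
    simp only [P, ENNReal.mul_rpow_of_nonneg _ _ (show (0 : ℝ) ≤ 2 by norm_num)]
    rw [lintegral_const_mul _ (by fun_prop),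
      lintegral_sub_left_eq_self (fun c => sixth h c ^ (2 : ℝ))]
  have e3 : ∫⁻ z, Q z ^ (2 : ℝ) ∂(volume.prod volume) ≤ κ * ∫⁻ b, sixth g b ^ (2 : ℝ) := by
    rw [lintegral_prod _ (by fun_prop), ← lintegral_const_mul _ (by fun_prop)]
    refine lintegral_mono_ae ?_
    filter_upwards [hne] with b hb
    simp only [Q, ENNReal.mul_rpow_of_nonneg _ _ (show (0 : ℝ) ≤ 2 by norm_num)]
    rw [lintegral_const_mul _ ((measurable_orderedKernel_left b).pow_const _), mul_comm]
    gcongr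
    exact hκ b hb
  refine e1.trans ((ENNReal.lintegral_mul_le_Lp_mul_Lq _ Real.HolderConjugate.two_two
    hP.aemeasurable hQ.aemeasurable).trans ?_)
  rw [e2]
  calc _ ≤ ((∫⁻ a, sixth f a ^ (2 : ℝ)) * ∫⁻ c, sixth h c ^ (2 : ℝ)) ^ (1 / 2 : ℝ) *
        (κ * ∫⁻ b, sixth g b ^ (2 : ℝ)) ^ (1 / 2 : ℝ) := by gcongr
    _ = _ := by
        rw [ENNReal.mul_rpow_of_nonneg _ _ (by norm_num),
          ENNReal.mul_rpow_of_nonneg _ _ (by norm_num), lnorm, lnorm, lnorm,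
          ENNReal.coe_rpow_of_nonneg _ (by norm_num)]
        ring

lemma mul_le_sum_ordered (f g h : Edim 1 → ℝ≥0∞) (a b c : Edim 1) :
    f a * g b * h c ≤ ordered f g h a b c + ordered g f h b a c + ordered f h g a c b +
      ordered h f g c a b + ordered g h f b c a + ordered h g f c b a := by
  have key : ∀ (f g h : Edim 1 → ℝ≥0∞) (a b c : Edim 1), ‖a‖ ≤ ‖b‖ → ‖b‖ ≤ ‖c‖ →
      ordered f g h a b c = f a * g b * h c := fun f g h a b c h1 h2 =>
    indicator_of_mem
      (s := {z : Edim 1 × Edim 1 × Edim 1 | ‖z.1‖ ≤ ‖z.2.1‖ ∧ ‖z.2.1‖ ≤ ‖z.2.2‖})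
      (a := (a, b, c)) ⟨h1, h2⟩ _
  have h1 : ∀ A B C D E F x : ℝ≥0∞, (x = A ∨ x = B ∨ x = C ∨ x = D ∨ x = E ∨ x = F) →
      x ≤ A + B + C + D + E + F := by
    rintro A B C D E F x (rfl | rfl | rfl | rfl | rfl | rfl)
    · simp only [add_assoc]; exact le_self_add
    · rw [add_comm A]; simp only [add_assoc]; exact le_self_add
    · rw [add_comm _ x]; simp only [add_assoc]; exact le_self_add
    · rw [add_comm _ x]; simp only [add_assoc]; exact le_self_add
    · rw [add_comm _ x]; simp only [add_assoc]; exact le_self_add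
    · exact le_add_self
  apply h1
  rcases le_total ‖a‖ ‖b‖ with hab | hab <;> rcases le_total ‖b‖ ‖c‖ with hbc | hbc <;>
    rcases le_total ‖a‖ ‖c‖ with hac | hac
  · left; rw [key _ _ _ _ _ _ hab hbc]
  · left; rw [key _ _ _ _ _ _ hab hbc]
  · right; right; left; rw [key _ _ _ _ _ _ hac hbc]; ring
  · right; right; right; left; rw [key _ _ _ _ _ _ hac hab]; ring
  · right; left; rw [key _ _ _ _ _ _ hab hac]; ring
  · right; right; right; right; left; rw [key _ _ _ _ _ _ hbc hac]; ring
  · right; right; right; right; right; rw [key _ _ _ _ _ _ hbc hab]; ring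
  · right; right; right; right; right; rw [key _ _ _ _ _ _ hbc hab]; ring

/-- The trilinear estimate dual to `Ḣ^{1/6}(ℝ) ⊂ L³(ℝ)`. -/
lemma trilinear_le : ∃ κ : ℝ≥0, ∀ f g h : Edim 1 → ℝ≥0∞, Measurable f →
    Measurable g → Measurable h → ∀ ξ, econv 1 (econv 1 f g) h ξ ≤
      κ * (lnorm 1 (sixth f) * lnorm 1 (sixth g) * lnorm 1 (sixth h)) := by
  obtain ⟨κ, hκ⟩ := planeIntegral_ordered_le
  refine ⟨6 * κ, fun f g h hf hg hh ξ => ?_⟩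
  have e0 : econv 1 (econv 1 f g) h ξ = planeIntegral ξ fun a b c => g a * h b * f c := by
    unfold econv planeIntegral
    refine lintegral_congr fun b => ?_
    rw [← lintegral_mul_const _ (by fun_prop)]
    refine lintegral_congr fun a => ?_
    rw [sub_right_comm]; ring
  have add : ∀ Φ Ψ : Edim 1 → Edim 1 → Edim 1 → ℝ≥0∞,
      (Measurable fun z : Edim 1 × Edim 1 × Edim 1 => Ψ z.1 z.2.1 z.2.2) →
      planeIntegral ξ (fun a b c => Φ a b c + Ψ a b c) =
        planeIntegral ξ Φ + planeIntegral ξ Ψ := by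
    intro Φ Ψ hΨ
    have hm : Measurable fun z : Edim 1 × Edim 1 => Ψ z.2 z.1 (ξ - z.2 - z.1) :=
      hΨ.comp (show Measurable fun z : Edim 1 × Edim 1 => (z.2, z.1, ξ - z.2 - z.1) by fun_prop)
    unfold planeIntegral
    rw [← lintegral_add_right _ hm.lintegral_prod_right']
    refine lintegral_congr fun b => lintegral_add_right _ ?_
    exact hm.comp (measurable_const.prodMk measurable_id)
  have m : ∀ f g h : Edim 1 → ℝ≥0∞, Measurable f → Measurable g → Measurable h →
      Measurable fun z : Edim 1 × Edim 1 × Edim 1 => ordered f g h z.1 z.2.1 z.2.2 :=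
    fun f g h hf hg hh => measurable_ordered hf hg hh
  have p : ∀ {Φ : Edim 1 → Edim 1 → Edim 1 → ℝ≥0∞}
      {τ : Edim 1 × Edim 1 × Edim 1 → Edim 1 × Edim 1 × Edim 1}, Measurable τ →
      (Measurable fun z : Edim 1 × Edim 1 × Edim 1 => Φ z.1 z.2.1 z.2.2) →
      Measurable fun z => Φ (τ z).1 (τ z).2.1 (τ z).2.2 := fun hτ hΦ => hΦ.comp hτ
  have s1 : ∀ {Φ : Edim 1 → Edim 1 → Edim 1 → ℝ≥0∞},
      (Measurable fun z : Edim 1 × Edim 1 × Edim 1 => Φ z.1 z.2.1 z.2.2) →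
      planeIntegral ξ (fun a b c => Φ c a b) = planeIntegral ξ Φ := fun {Φ} hΦ => by
    rw [planeIntegral_swap₁₂ ξ (Φ := fun a b c => Φ c b a)
      (p (τ := fun z => (z.2.2, z.2.1, z.1)) (by fun_prop) hΦ), planeIntegral_swap₁₃]
  have s2 : ∀ {Φ : Edim 1 → Edim 1 → Edim 1 → ℝ≥0∞},
      (Measurable fun z : Edim 1 × Edim 1 × Edim 1 => Φ z.1 z.2.1 z.2.2) →
      planeIntegral ξ (fun a b c => Φ b c a) = planeIntegral ξ Φ := fun {Φ} hΦ => by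
    rw [planeIntegral_swap₁₃ ξ (fun a b c => Φ b a c), planeIntegral_swap₁₂ ξ hΦ]
  have s3 : ∀ {Φ : Edim 1 → Edim 1 → Edim 1 → ℝ≥0∞},
      (Measurable fun z : Edim 1 × Edim 1 × Edim 1 => Φ z.1 z.2.1 z.2.2) →
      planeIntegral ξ (fun a b c => Φ a c b) = planeIntegral ξ Φ := fun {Φ} hΦ => by
    rw [planeIntegral_swap₁₂ ξ (Φ := fun a b c => Φ b c a)
      (p (τ := fun z => (z.2.1, z.2.2, z.1)) (by fun_prop) hΦ), s2 hΦ]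
  rw [e0]
  calc _ ≤ planeIntegral ξ (fun a b c => ordered g h f a b c + ordered h g f b a c +
          ordered g f h a c b + ordered f g h c a b + ordered h f g b c a + ordered f h g c b a) :=
        lintegral_mono fun b => lintegral_mono fun a => mul_le_sum_ordered g h f a b _
    _ = planeIntegral ξ (ordered g h f) + planeIntegral ξ (ordered h g f) +
        planeIntegral ξ (ordered g f h) + planeIntegral ξ (ordered f g h) +
        planeIntegral ξ (ordered h f g) + planeIntegral ξ (ordered f h g) := by
        rw [add _ _ (p (τ := fun z => (z.2.2, z.2.1, z.1)) (by fun_prop) (m f h g hf hh hg)),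
          add _ _ (p (τ := fun z => (z.2.1, z.2.2, z.1)) (by fun_prop) (m h f g hh hf hg)),
          add _ _ (p (τ := fun z => (z.2.2, z.1, z.2.1)) (by fun_prop) (m f g h hf hg hh)),
          add _ _ (p (τ := fun z => (z.1, z.2.2, z.2.1)) (by fun_prop) (m g f h hg hf hh)),
          add _ _ (p (τ := fun z => (z.2.1, z.1, z.2.2)) (by fun_prop) (m h g f hh hg hf)),
          planeIntegral_swap₁₂ ξ (m h g f hh hg hf), s3 (m g f h hg hf hh),
          s1 (m f g h hf hg hh), s2 (m h f g hh hf hg), planeIntegral_swap₁₃ ξ (ordered f h g)]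
    _ ≤ κ * (lnorm 1 (sixth g) * lnorm 1 (sixth h) * lnorm 1 (sixth f)) +
        κ * (lnorm 1 (sixth h) * lnorm 1 (sixth g) * lnorm 1 (sixth f)) +
        κ * (lnorm 1 (sixth g) * lnorm 1 (sixth f) * lnorm 1 (sixth h)) +
        κ * (lnorm 1 (sixth f) * lnorm 1 (sixth g) * lnorm 1 (sixth h)) +
        κ * (lnorm 1 (sixth h) * lnorm 1 (sixth f) * lnorm 1 (sixth g)) +
        κ * (lnorm 1 (sixth f) * lnorm 1 (sixth h) * lnorm 1 (sixth g)) := by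
        gcongr <;> apply hκ <;> assumption
    _ = _ := by push_cast; ring

end Trilinear

section Nonlinearity

variable {d : ℕ}

/-- The regularity `σ = d (1/2 - 1/k)` for which `Ḣ^σ ⊂ L^k`. -/
def sobolevExponent (d k : ℕ) : ℝ := (d : ℝ) * (1 / 2 - 1 / (k : ℝ))

lemma HdotNorm_one_sixth (F : Edim 1 → ℂ) :
    HdotNorm 1 (1 / 6) F = lnorm 1 (sixth fun ξ => ‖F ξ‖ₑ) :=
  HdotNorm_eq_lnorm _ _

lemma enorm_conv_self_sub_le {f g : Edim d → ℂ} (hf : Measurable f) (hg : Measurable g)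
    (hf0 : HdotNorm d 0 f < ⊤) (hg0 : HdotNorm d 0 g < ⊤) (ξ : Edim d) :
    ‖conv d f f ξ - conv d g g ξ‖ₑ ≤
      econv d (fun η => ‖f η - g η‖ₑ) (fun η => ‖f η‖ₑ) ξ +
        econv d (fun η => ‖g η‖ₑ) (fun η => ‖f η - g η‖ₑ) ξ := by
  rw [HdotNorm_zero_eq_lnorm] at hf0 hg0
  refine enorm_conv_sub_conv_le hf hf hg hg ?_ ?_
  · exact (econv_le (by fun_prop) (by fun_prop) ξ).trans_lt (ENNReal.mul_lt_top hf0 hf0)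
  · exact (econv_le (by fun_prop) (by fun_prop) ξ).trans_lt (ENNReal.mul_lt_top hg0 hg0)

lemma enorm_convIter_one_sub_le {f g : Edim d → ℂ} (hf : Measurable f) (hg : Measurable g)
    {M : ℝ≥0∞} (hM : M < ⊤) (hfM : HdotNorm d 0 f ≤ M) (hgM : HdotNorm d 0 g ≤ M) (ξ : Edim d) :
    ‖convIter d f 1 ξ - convIter d g 1 ξ‖ₑ ≤ 2 * M * HdotNorm d 0 (fun ξ => f ξ - g ξ) := by
  refine (enorm_conv_self_sub_le hf hg (hfM.trans_lt hM) (hgM.trans_lt hM) ξ).trans ?_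
  rw [HdotNorm_zero_eq_lnorm] at hfM hgM ⊢
  calc _ ≤ lnorm d (fun η => ‖f η - g η‖ₑ) * lnorm d (fun η => ‖f η‖ₑ) +
        lnorm d (fun η => ‖g η‖ₑ) * lnorm d (fun η => ‖f η - g η‖ₑ) :=
      add_le_add (econv_le (by fun_prop) (by fun_prop) ξ) (econv_le (by fun_prop) (by fun_prop) ξ)
    _ ≤ lnorm d (fun η => ‖f η - g η‖ₑ) * M + M * lnorm d (fun η => ‖f η - g η‖ₑ) := by gcongr
    _ = _ := by ring

lemma econv_add_left {f f' g : Edim d → ℝ≥0∞} (hf : Measurable f) (hg : Measurable g)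
    (ξ : Edim d) : econv d (f + f') g ξ = econv d f g ξ + econv d f' g ξ := by
  unfold econv
  rw [← lintegral_add_left (by fun_prop)]
  simp only [Pi.add_apply, add_mul]

lemma measurable_econv {f g : Edim d → ℝ≥0∞} (hf : Measurable f) (hg : Measurable g) :
    Measurable (econv d f g) := by
  have : Measurable fun z : Edim d × Edim d => f (z.1 - z.2) * g z.2 := by fun_prop
  exact this.lintegral_prod_right'

lemma enorm_convIter_two_sub_le : ∃ c : ℝ≥0, ∀ {f g : Edim 1 → ℂ}, Measurable f → Measurable g →
    HdotNorm 1 0 f < ⊤ → HdotNorm 1 0 g < ⊤ → ∀ {M : ℝ≥0∞}, M < ⊤ → HdotNorm 1 (1 / 6) f ≤ M →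
    HdotNorm 1 (1 / 6) g ≤ M → ∀ ξ, ‖convIter 1 f 2 ξ - convIter 1 g 2 ξ‖ₑ ≤
      c * M ^ 2 * HdotNorm 1 (1 / 6) (fun ξ => f ξ - g ξ) := by
  obtain ⟨κ, hκ⟩ := trilinear_le
  refine ⟨3 * κ, fun {f g} hf hg hf0 hg0 M hM hfM hgM ξ => ?_⟩
  rw [HdotNorm_one_sixth] at hfM hgM ⊢
  set f' : Edim 1 → ℝ≥0∞ := fun η => ‖f η‖ₑ
  set g' : Edim 1 → ℝ≥0∞ := fun η => ‖g η‖ₑ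
  set w : Edim 1 → ℝ≥0∞ := fun η => ‖f η - g η‖ₑ
  have hf' : Measurable f' := by fun_prop
  have hg' : Measurable g' := by fun_prop
  have hw : Measurable w := by fun_prop
  have fin : ∀ {h : Edim 1 → ℂ}, Measurable h → lnorm 1 (sixth fun η => ‖h η‖ₑ) ≤ M →
      econv 1 (fun η => ‖conv 1 h h η‖ₑ) (fun η => ‖h η‖ₑ) ξ < ⊤ := by
    intro h hh hhM
    have hm : Measurable fun η => ‖h η‖ₑ := by fun_prop
    refine (econv_mono (enorm_conv_le h h) le_rfl ξ).trans_lt ((hκ _ _ _ hm hm hm ξ).trans_lt ?_)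
    have := hhM.trans_lt hM
    exact ENNReal.mul_lt_top ENNReal.coe_lt_top
      (ENNReal.mul_lt_top (ENNReal.mul_lt_top this this) this)
  have h1 := enorm_conv_sub_conv_le (measurable_conv hf hf) hf (measurable_conv hg hg) hg
    (fin hf hfM) (fin hg hgM)
  refine h1.trans ?_
  calc _ ≤ econv 1 (econv 1 w f' + econv 1 g' w) f' ξ + econv 1 (econv 1 g' g') w ξ :=
        add_le_add (econv_mono (enorm_conv_self_sub_le hf hg hf0 hg0) le_rfl ξ)
          (econv_mono (enorm_conv_le g g) le_rfl ξ)
    _ = econv 1 (econv 1 w f') f' ξ + econv 1 (econv 1 g' w) f' ξ +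
          econv 1 (econv 1 g' g') w ξ := by
        rw [econv_add_left (measurable_econv hw hf') hf']
    _ ≤ κ * (lnorm 1 (sixth w) * lnorm 1 (sixth f') * lnorm 1 (sixth f')) +
          κ * (lnorm 1 (sixth g') * lnorm 1 (sixth w) * lnorm 1 (sixth f')) +
          κ * (lnorm 1 (sixth g') * lnorm 1 (sixth g') * lnorm 1 (sixth w)) := by
        gcongr <;> apply hκ <;> assumption
    _ ≤ κ * (lnorm 1 (sixth w) * M * M) + κ * (M * lnorm 1 (sixth w) * M) +
          κ * (M * M * lnorm 1 (sixth w)) := by gcongr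
    _ = _ := by push_cast; ring

/-- The Lipschitz estimate for `u ↦ u^k` from `Ḣ^σ` to `𝓕L^∞`. -/
lemma enorm_convIter_sub_le {k : ℕ}
    (hdk : ((d = 1 ∨ d = 2 ∨ d = 3) ∧ k = 2) ∨ (d = 1 ∧ k = 3)) :
    ∃ c : ℝ≥0, ∀ {f g : Edim d → ℂ}, Measurable f → Measurable g →
      HdotNorm d 0 f < ⊤ → HdotNorm d 0 g < ⊤ → ∀ {M : ℝ≥0∞}, M < ⊤ →
      HdotNorm d (sobolevExponent d k) f ≤ M → HdotNorm d (sobolevExponent d k) g ≤ M →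
      ∀ ξ, ‖convIter d f (k - 1) ξ - convIter d g (k - 1) ξ‖ₑ ≤
        c * M ^ (k - 1) * HdotNorm d (sobolevExponent d k) (fun ξ => f ξ - g ξ) := by
  rcases hdk with ⟨-, rfl⟩ | ⟨rfl, rfl⟩
  · have : sobolevExponent d 2 = 0 := by norm_num [sobolevExponent]
    rw [this]
    refine ⟨2, fun {f g} hf hg _ _ M hM hfM hgM ξ => ?_⟩
    simpa using enorm_convIter_one_sub_le hf hg hM hfM hgM ξ
  · have : sobolevExponent 1 3 = 1 / 6 := by norm_num [sobolevExponent]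
    rw [this]
    exact enorm_convIter_two_sub_le

/-- Away from low frequencies `Ḣ^σ` controls `L²`, and `H^s` controls the low frequencies. -/
lemma HdotNorm_zero_lt_top {s σ : ℝ} (hs : s ≤ 0) (hσ : 0 ≤ σ) {F : Edim d → ℂ}
    (h1 : HsNormSq d s F < ⊤) (h2 : HdotNorm d σ F < ⊤) (hF : Measurable F) :
    HdotNorm d 0 F < ⊤ := by
  have h2' : HdotNormSq d σ F < ⊤ := by
    by_contra h
    rw [HdotNorm, not_lt_top_iff.1 h, ENNReal.top_rpow_of_pos (by norm_num)] at h2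
    exact lt_irrefl _ h2
  refine ENNReal.rpow_lt_top_of_nonneg (by norm_num) (ne_of_lt ?_)
  have key : HdotNormSq d 0 F ≤ ENNReal.ofReal (2 ^ (-s)) * HsNormSq d s F + HdotNormSq d σ F := by
    unfold HdotNormSq HsNormSq
    rw [← lintegral_const_mul' _ _ ENNReal.ofReal_ne_top, ← lintegral_add_right _ (by fun_prop)]
    refine lintegral_mono fun ξ => ?_
    rw [← ENNReal.ofReal_mul (by positivity), ← ENNReal.ofReal_add (by positivity) (by positivity)]
    refine ENNReal.ofReal_le_ofReal ?_
    have hw : (1 : ℝ) ≤ 2 ^ (-s) * (1 + ‖ξ‖ ^ 2) ^ s + ‖ξ‖ ^ (2 * σ) := by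
      rcases le_total ‖ξ‖ 1 with h | h
      · have : (2 : ℝ) ^ s ≤ (1 + ‖ξ‖ ^ 2) ^ s :=
          Real.rpow_le_rpow_of_nonpos (by positivity) (by nlinarith [norm_nonneg ξ]) hs
        calc (1 : ℝ) = 2 ^ (-s) * 2 ^ s := by rw [← Real.rpow_add (by norm_num)]; simp
          _ ≤ 2 ^ (-s) * (1 + ‖ξ‖ ^ 2) ^ s := by gcongr
          _ ≤ _ := le_add_of_nonneg_right (by positivity)
      · exact (Real.one_le_rpow h (by positivity)).trans
          (le_add_of_nonneg_left (by positivity))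
    have := mul_le_mul_of_nonneg_right hw (sq_nonneg ‖F ξ‖)
    simp only [mul_zero, Real.rpow_zero]
    linarith
  exact key.trans_lt (ENNReal.add_lt_top.2 ⟨ENNReal.mul_lt_top ENNReal.ofReal_lt_top h1, h2'⟩)

end Nonlinearity

section Modification

variable {d : ℕ} {s T : ℝ}

lemma HsContinuousOn.uniform {u : ℝ → Edim d → ℂ} (hu : HsContinuousOn d s (Icc 0 T) u)
    (hm : ∀ t ∈ Icc 0 T, Measurable (u t)) {ε : ℝ≥0∞} (hε : 0 < ε) :
    ∃ δ > 0, ∀ t ∈ Icc 0 T, ∀ t' ∈ Icc 0 T, dist t t' < δ →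
      HsNormSq d s (fun ξ => u t ξ - u t' ξ) < ε := by
  set ε' : ℝ≥0∞ := ε ^ (1 / 2 : ℝ) / 2
  have hε' : 0 < ε' := ENNReal.half_pos (by simp [hε.ne'])
  have h : ∀ t₀ : Icc 0 T, ∃ δ > 0, ∀ t : ℝ, dist t t₀ < δ → t ∈ Icc 0 T →
      HsNorm d s (fun ξ => u t ξ - u t₀ ξ) < ε' := fun t₀ => by
    have := (hu t₀ t₀.2).eventually (gt_mem_nhds hε')
    rwa [eventually_nhdsWithin_iff, Metric.eventually_nhds_iff] at this
  choose δ hδ h using h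
  obtain ⟨η, hη, hb⟩ := lebesgue_number_lemma_of_metric (isCompact_Icc (a := 0) (b := T))
    (c := fun t₀ : Icc 0 T => Metric.ball (t₀ : ℝ) (δ t₀)) (fun _ => Metric.isOpen_ball)
    fun t ht => mem_iUnion.2 ⟨⟨t, ht⟩, Metric.mem_ball_self (hδ _)⟩
  refine ⟨η, hη, fun t ht t' ht' htt' => ?_⟩
  obtain ⟨t₀, hb⟩ := hb t' ht'
  have h1 := h t₀ t (hb htt') ht
  have h2 := h t₀ t' (hb (Metric.mem_ball_self hη)) ht'
  have h3 : HsNorm d s (fun ξ => u t ξ - u t' ξ) < ε ^ (1 / 2 : ℝ) := by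
    calc _ = HsNorm d s (fun ξ => (u t ξ - u t₀ ξ) - (u t' ξ - u t₀ ξ)) := by
          simp only [sub_sub_sub_cancel_right]
      _ ≤ _ := HsNorm_sub_le ((hm t ht).sub (hm t₀ t₀.2)) ((hm t' ht').sub (hm t₀ t₀.2))
      _ < ε' + ε' := ENNReal.add_lt_add h1 h2
      _ = _ := ENNReal.add_halves _
  exact (ENNReal.rpow_lt_rpow_iff (by norm_num)).1 h3

lemma ae_tendsto_of_tsum_HsNormSq {v : ℕ → Edim d → ℂ} {u : Edim d → ℂ}
    (hv : ∀ n, Measurable (v n)) (hu : Measurable u)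
    (h : ∑' n, HsNormSq d s (fun ξ => v n ξ - u ξ) ≠ ⊤) :
    ∀ᵐ ξ, Tendsto (fun n => v n ξ) atTop (𝓝 (u ξ)) := by
  unfold HsNormSq at h
  rw [← lintegral_tsum fun n => by have := hv n; fun_prop] at h
  filter_upwards [ae_lt_top' (AEMeasurable.tsum fun n => by have := hv n; fun_prop) h]
    with ξ hξ
  have h1 := ENNReal.tendsto_atTop_zero_of_tsum_ne_top hξ.ne
  have h2 := (ENNReal.tendsto_toReal ENNReal.zero_ne_top).comp h1
  have hw : (0 : ℝ) < (1 + ‖ξ‖ ^ 2) ^ s := by positivity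
  have h3 := h2.const_mul ((1 + ‖ξ‖ ^ 2) ^ s)⁻¹
  simp only [ENNReal.toReal_zero, mul_zero] at h3
  rw [tendsto_iff_norm_sub_tendsto_zero]
  have h4 : Tendsto (fun n => ‖v n ξ - u ξ‖ ^ 2) atTop (𝓝 0) := by
    refine h3.congr fun n => ?_
    simp only [Function.comp_apply]
    rw [ENNReal.toReal_ofReal (by positivity), inv_mul_cancel_left₀ hw.ne']
  have h5 := (Real.continuous_sqrt.tendsto 0).comp h4
  simpa [Function.comp_def] using h5

/-- Sampling times `⌊m t⌋ / m`, forced into `[0, T]`. -/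
def sampleTime (T : ℝ) (hT : 0 ≤ T) (m : ℕ) (z : ℤ) : ℝ := projIcc 0 T hT (z / (m + 1))

lemma sampleTime_mem (hT : 0 ≤ T) (m : ℕ) (z : ℤ) : sampleTime T hT m z ∈ Icc 0 T :=
  (projIcc 0 T hT _).2

lemma dist_sampleTime_lt (hT : 0 ≤ T) (m : ℕ) {t : ℝ} (ht : t ∈ Icc 0 T) :
    dist (sampleTime T hT m ⌊t * (m + 1)⌋) t ≤ 1 / (m + 1) := by
  have hpos : (0 : ℝ) < m + 1 := by positivity
  have h1 : (⌊t * (m + 1)⌋ : ℝ) / (m + 1) ≤ t := by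
    rw [div_le_iff₀ hpos]; exact Int.floor_le _
  have h2 : t - 1 / (m + 1) < (⌊t * (m + 1)⌋ : ℝ) / (m + 1) := by
    rw [lt_div_iff₀ hpos, sub_mul, one_div, inv_mul_cancel₀ hpos.ne']
    exact Int.sub_one_lt_floor _
  have h3 : (0 : ℝ) ≤ (⌊t * (m + 1)⌋ : ℝ) / (m + 1) := by
    have : 0 ≤ ⌊t * (m + 1)⌋ := Int.floor_nonneg.2 (mul_nonneg ht.1 hpos.le)
    have : (0 : ℝ) ≤ (⌊t * (m + 1)⌋ : ℝ) := by exact_mod_cast this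
    positivity
  have h4 : (0 : ℝ) ≤ 1 / (m + 1) := by positivity
  rw [sampleTime, projIcc_of_mem hT ⟨h3, h1.trans ht.2⟩, Real.dist_eq, abs_sub_le_iff]
  constructor <;> linarith

lemma measurable_sample {u : ℝ → Edim d → ℂ} (hT : 0 ≤ T)
    (hm : ∀ t ∈ Icc 0 T, Measurable (u t)) (m : ℕ) :
    Measurable fun z : ℝ × Edim d => u (sampleTime T hT m ⌊z.1 * (m + 1)⌋) z.2 := by
  have h1 : Measurable fun z : ℤ × Edim d => u (sampleTime T hT m z.1) z.2 :=
    measurable_from_prod_countable_right fun z => hm _ (sampleTime_mem hT m z)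
  have h2 : Measurable fun z : ℝ × Edim d => (⌊z.1 * (m + 1)⌋, z.2) :=
    (Int.measurable_floor.comp (by fun_prop)).prodMk measurable_snd
  have h3 := h1.comp h2
  simpa only [Function.comp_def] using h3

/-- A continuous curve in `H^s` has a jointly measurable modification. -/
lemma HsContinuousOn.exists_measurable_modification {u : ℝ → Edim d → ℂ} (hT : 0 ≤ T)
    (hu : HsContinuousOn d s (Icc 0 T) u) (hm : ∀ t ∈ Icc 0 T, Measurable (u t)) :
    ∃ v : ℝ → Edim d → ℂ, (Measurable fun z : ℝ × Edim d => v z.1 z.2) ∧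
      ∀ t ∈ Icc 0 T, v t =ᵐ[volume] u t := by
  have hε : ∀ n : ℕ, (0 : ℝ≥0∞) < 2⁻¹ ^ n := fun n => ENNReal.pow_pos (by simp) n
  choose δ hδ h using fun n => hu.uniform hm (hε n)
  choose m hm0 using fun n => exists_nat_one_div_lt (hδ n)
  refine ⟨fun t ξ => limUnder atTop fun n => u (sampleTime T hT (m n) ⌊t * (m n + 1)⌋) ξ,
    (StronglyMeasurable.limUnder fun n =>
      (measurable_sample hT hm (m n)).stronglyMeasurable).measurable, fun t ht => ?_⟩
  have hsum : ∑' n, HsNormSq d s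
      (fun ξ => u (sampleTime T hT (m n) ⌊t * (m n + 1)⌋) ξ - u t ξ) ≠ ⊤ := by
    refine ne_top_of_le_ne_top ?_ (ENNReal.tsum_le_tsum fun n =>
      (h n _ (sampleTime_mem hT _ _) t ht ((dist_sampleTime_lt hT _ ht).trans_lt (hm0 n))).le)
    rw [ENNReal.tsum_geometric]
    simp
  filter_upwards [ae_tendsto_of_tsum_HsNormSq (fun n => hm _ (sampleTime_mem hT _ _)) (hm t ht)
    hsum] with ξ hξ
  exact hξ.limUnder_eq

end Modification

section Beta

/-- The real Beta integral `∫₀¹ (1-x)^a x^b dx`. -/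
def betaConst (a b : ℝ) : ℝ := ∫ x in (0 : ℝ)..1, (1 - x) ^ a * x ^ b

lemma betaConst_nonneg (a b : ℝ) : 0 ≤ betaConst a b :=
  intervalIntegral.integral_nonneg zero_le_one fun x hx => by
    have := sub_nonneg.2 hx.2
    have := hx.1
    positivity

lemma intervalIntegrable_beta_one {a b : ℝ} (ha : -1 < a) (hb : -1 < b) :
    IntervalIntegrable (fun x : ℝ => (1 - x) ^ a * x ^ b) volume 0 1 := by
  have h := (Complex.betaIntegral_convergent (u := ((b + 1 : ℝ) : ℂ)) (v := ((a + 1 : ℝ) : ℂ))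
    (by rw [Complex.ofReal_re]; linarith) (by rw [Complex.ofReal_re]; linarith)).norm
  refine h.congr_ae ?_
  rw [uIoc_of_le zero_le_one]
  filter_upwards [ae_restrict_mem measurableSet_Ioc, ae_restrict_of_ae (Measure.ae_ne volume 1)]
    with x hx hx1
  have h0 : 0 < 1 - x := sub_pos.2 (lt_of_le_of_ne hx.2 hx1)
  rw [norm_mul, Complex.norm_cpow_eq_rpow_re_of_pos hx.1,
    show (1 - (x : ℂ)) = ((1 - x : ℝ) : ℂ) by push_cast; ring,
    Complex.norm_cpow_eq_rpow_re_of_pos h0, mul_comm]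
  simp

lemma beta_scaling {a b t x : ℝ} (ht : 0 < t) (hx : x ∈ Icc 0 t) :
    t ^ (a + b) * ((1 - x / t) ^ a * (x / t) ^ b) = (t - x) ^ a * x ^ b := by
  have h1 : 0 ≤ 1 - x / t := sub_nonneg.2 ((div_le_one ht).2 hx.2)
  have h2 : 0 ≤ x / t := div_nonneg hx.1 ht.le
  calc _ = (t ^ a * (1 - x / t) ^ a) * (t ^ b * (x / t) ^ b) := by rw [Real.rpow_add ht]; ring
    _ = _ := by
      rw [← Real.mul_rpow ht.le h1, ← Real.mul_rpow ht.le h2]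
      congr 2 <;> field_simp

lemma intervalIntegrable_beta {a b t : ℝ} (ha : -1 < a) (hb : -1 < b) (ht : 0 < t) :
    IntervalIntegrable (fun x : ℝ => (t - x) ^ a * x ^ b) volume 0 t := by
  have h := ((intervalIntegrable_beta_one ha hb).comp_mul_left (c := t⁻¹)).const_mul (t ^ (a + b))
  simp only [zero_div, one_div, inv_inv] at h
  refine h.congr fun x hx => ?_
  rw [uIoc_of_le ht.le] at hx
  simp only [inv_mul_eq_div]
  exact beta_scaling ht ⟨hx.1.le, hx.2⟩

lemma integral_beta {a b t : ℝ} (ht : 0 < t) :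
    ∫ x in (0 : ℝ)..t, (t - x) ^ a * x ^ b = betaConst a b * t ^ (a + b + 1) := by
  have e : ∫ x in (0 : ℝ)..t, (t - x) ^ a * x ^ b =
      ∫ x in (0 : ℝ)..t, t ^ (a + b) * ((1 - x / t) ^ a * (x / t) ^ b) := by
    refine intervalIntegral.integral_congr fun x hx => ?_
    rw [uIcc_of_le ht.le] at hx
    exact (beta_scaling ht hx).symm
  rw [e, intervalIntegral.integral_const_mul,
    intervalIntegral.integral_comp_div (fun x => (1 - x) ^ a * x ^ b) ht.ne', zero_div,
    div_self ht.ne', smul_eq_mul, Real.rpow_add ht (a + b), Real.rpow_one, betaConst]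
  ring

end Beta

section Duhamel

variable {d : ℕ}

/-- The Duhamel operator `∫₀ᵗ W(t - t') n(t') dt'` for `t ∈ [0, T]`, written with a fixed domain
of integration. -/
def duhamel (d : ℕ) (T : ℝ) (n : ℝ → Edim d → ℂ) (t : ℝ) (ξ : Edim d) : ℂ :=
  ∫ t' in Ioo 0 T, ((Wsym (max (t - t') 0) ‖ξ‖ : ℝ) : ℂ) * n t' ξ

lemma duhamel_eq_intervalIntegral {T t : ℝ} (ht : t ∈ Icc 0 T) (n : ℝ → Edim d → ℂ)
    (ξ : Edim d) :
    duhamel d T n t ξ = ∫ t' in (0 : ℝ)..t, ((Wsym (t - t') ‖ξ‖ : ℝ) : ℂ) * n t' ξ := by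
  rw [intervalIntegral.integral_of_le ht.1, integral_Ioc_eq_integral_Ioo, duhamel,
    setIntegral_eq_of_subset_of_forall_sdiff_eq_zero measurableSet_Ioo
      (Ioo_subset_Ioo_right ht.2)]
  · refine setIntegral_congr_fun measurableSet_Ioo fun t' ht' => ?_
    simp only [max_eq_left (sub_nonneg.2 ht'.2.le)]
  · rintro t' ⟨h1, h2⟩
    have : t ≤ t' := not_lt.1 fun h => h2 ⟨h1.1, h⟩
    rw [max_eq_right (sub_nonpos.2 this), Wsym_zero]
    simp

lemma duhamel_zero_time {T : ℝ} (hT : 0 ≤ T) (n : ℝ → Edim d → ℂ) (ξ : Edim d) :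
    duhamel d T n 0 ξ = 0 := by
  rw [duhamel_eq_intervalIntegral ⟨le_rfl, hT⟩, intervalIntegral.integral_same]

lemma measurable_duhamel {n : ℝ → Edim d → ℂ} (hn : Measurable fun z : ℝ × Edim d => n z.1 z.2)
    (T : ℝ) : Measurable fun z : ℝ × Edim d => duhamel d T n z.1 z.2 := by
  have h1 : Measurable fun z : (ℝ × Edim d) × ℝ =>
      ((Wsym (max (z.1.1 - z.2) 0) ‖z.1.2‖ : ℝ) : ℂ) := by
    have := measurable_Wsym.comp (show Measurable fun z : (ℝ × Edim d) × ℝ =>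
      (max (z.1.1 - z.2) 0, ‖z.1.2‖) by fun_prop)
    exact Complex.measurable_ofReal.comp this
  have h2 : Measurable fun z : (ℝ × Edim d) × ℝ => n z.2 z.1.2 :=
    hn.comp (show Measurable fun z : (ℝ × Edim d) × ℝ => (z.2, z.1.2) by fun_prop)
  exact (h1.mul h2).stronglyMeasurable.integral_prod_right.measurable

/-- The source term `n` is jointly measurable and `O(t^{-p})` uniformly in frequency. -/
structure SourceBound (d : ℕ) (T p M : ℝ) (n : ℝ → Edim d → ℂ) : Prop where
  measurable : Measurable fun z : ℝ × Edim d => n z.1 z.2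
  bound : ∀ t ∈ Ioo 0 T, ∀ ξ, ‖n t ξ‖ ≤ M * t ^ (-p)

variable {T p M M' : ℝ} {n n' : ℝ → Edim d → ℂ}

lemma SourceBound.aestronglyMeasurable (h : SourceBound d T p M n) (t : ℝ) (ξ : Edim d) :
    AEStronglyMeasurable (fun t' => ((Wsym (max (t - t') 0) ‖ξ‖ : ℝ) : ℂ) * n t' ξ)
      (volume.restrict (Ioo 0 T)) := by
  have h1 : Continuous fun t' => ((Wsym (max (t - t') 0) ‖ξ‖ : ℝ) : ℂ) :=
    Complex.continuous_ofReal.comp ((continuous_Wsym _).comp (by fun_prop))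
  have h2 : Measurable fun t' => n t' ξ := by
    have := h.measurable.comp (show Measurable fun t' : ℝ => (t', ξ) by fun_prop)
    simpa only [Function.comp_def] using this
  exact (h1.measurable.mul h2).aestronglyMeasurable

lemma SourceBound.norm_integrand_le (h : SourceBound d T p M n) (hT1 : T ≤ 1) {t : ℝ}
    (ht : t ∈ Icc 0 T) (ξ : Edim d) :
    ∀ᵐ t' ∂(volume.restrict (Ioo 0 T)),
      ‖((Wsym (max (t - t') 0) ‖ξ‖ : ℝ) : ℂ) * n t' ξ‖ ≤ M * t' ^ (-p) := by
  filter_upwards [ae_restrict_mem measurableSet_Ioo] with t' ht'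
  have hb := h.bound t' ht' ξ
  rw [norm_mul, Complex.norm_real, Real.norm_eq_abs]
  refine (mul_le_of_le_one_left (norm_nonneg _) (abs_Wsym_le_one (le_max_right _ _)
    (max_le ?_ zero_le_one) (norm_nonneg _))).trans hb
  linarith [ht.2, ht'.1]

lemma integrableOn_source (hp : p < 1) (hT : 0 ≤ T) :
    Integrable (fun t : ℝ => M * t ^ (-p)) (volume.restrict (Ioo 0 T)) := by
  have := (intervalIntegral.intervalIntegrable_rpow' (a := 0) (b := T) (r := -p)
    (by linarith)).const_mul M
  rw [intervalIntegrable_iff_integrableOn_Ioo_of_le hT] at this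
  exact this

lemma SourceBound.integrable (h : SourceBound d T p M n) (hp : p < 1) (hT1 : T ≤ 1) {t : ℝ}
    (ht : t ∈ Icc 0 T) (ξ : Edim d) :
    Integrable (fun t' => ((Wsym (max (t - t') 0) ‖ξ‖ : ℝ) : ℂ) * n t' ξ)
      (volume.restrict (Ioo 0 T)) :=
  (integrableOn_source hp (ht.1.trans ht.2)).mono' (h.aestronglyMeasurable t ξ)
    (h.norm_integrand_le hT1 ht ξ)

lemma duhamel_sub (h : SourceBound d T p M n) (h' : SourceBound d T p M' n') (hp : p < 1)
    (hT1 : T ≤ 1) {t : ℝ} (ht : t ∈ Icc 0 T) (ξ : Edim d) :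
    duhamel d T n t ξ - duhamel d T n' t ξ = duhamel d T (fun t ξ => n t ξ - n' t ξ) t ξ := by
  unfold duhamel
  rw [← integral_sub (h.integrable hp hT1 ht ξ) (h'.integrable hp hT1 ht ξ)]
  simp only [mul_sub]

lemma SourceBound.continuousOn_duhamel (h : SourceBound d T p M n) (hp : p < 1) (hT1 : T ≤ 1)
    (hT : 0 ≤ T) (ξ : Edim d) : ContinuousOn (fun t => duhamel d T n t ξ) (Icc 0 T) := by
  refine continuousOn_of_dominated (fun t _ => h.aestronglyMeasurable t ξ)
    (fun t ht => h.norm_integrand_le hT1 ht ξ) (integrableOn_source hp hT)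
    (Eventually.of_forall fun t' => Continuous.continuousOn ?_)
  exact (Complex.continuous_ofReal.comp ((continuous_Wsym _).comp (by fun_prop))).mul
    continuous_const

lemma SourceBound.norm_duhamel_le (h : SourceBound d T p M n) (hp : p < 1) (hT1 : T ≤ 1)
    {γ : ℝ} (hγ : 0 ≤ γ) (hγ2 : γ < 2) {t : ℝ} (ht : t ∈ Ioc 0 T) (ξ : Edim d) :
    ‖duhamel d T n t ξ‖ ≤
      8 * M * betaConst (1 - γ) (-p) * t ^ (2 - γ - p) * bracket d (-γ) ξ := by
  rw [duhamel_eq_intervalIntegral ⟨ht.1.le, ht.2⟩]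
  refine (intervalIntegral.norm_integral_le_of_norm_le ht.1.le (g := fun t' =>
    (8 * M * bracket d (-γ) ξ) * ((t - t') ^ (1 - γ) * t' ^ (-p))) ?_ ?_).trans_eq ?_
  · filter_upwards [Measure.ae_ne volume t] with t' hne ht'
    have h1 : 0 < t - t' := sub_pos.2 (lt_of_le_of_ne ht'.2 hne)
    have h2 := h.bound t' ⟨ht'.1, (sub_pos.1 h1).trans_le ht.2⟩ ξ
    have h3 := abs_Wsym_le h1 (by linarith [ht.2, ht'.1]) hγ hγ2.le ξ
    rw [norm_mul, Complex.norm_real, Real.norm_eq_abs]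
    calc _ ≤ (8 * (t - t') ^ (1 - γ) * bracket d (-γ) ξ) * (M * t' ^ (-p)) :=
          mul_le_mul h3 h2 (norm_nonneg _) ((abs_nonneg _).trans h3)
      _ = _ := by ring
  · exact (intervalIntegrable_beta (by linarith) (by linarith) ht.1).const_mul _
  · rw [intervalIntegral.integral_const_mul, integral_beta ht.1,
      show 1 - γ + -p + 1 = 2 - γ - p by ring]
    ring

end Duhamel

section KernelBounds

variable {d : ℕ} {σ s p γ₁ γ₂ κ T : ℝ}

/-- Numerology of the fixed point argument: the source is `O(t^{-p})`, and the gains `γ₁` and `γ₂`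
of the kernel control `H^s` and `Ḣ^σ` respectively, leaving a factor `T^κ`. -/
structure Admissible (d : ℕ) (σ s p γ₁ γ₂ κ : ℝ) : Prop where
  σ_nonneg : 0 ≤ σ
  s_nonpos : s ≤ 0
  gap : σ - s ≤ 1
  p_lt : p < 1
  γ₁_nonneg : 0 ≤ γ₁
  γ₁_lt : γ₁ < 2
  γ₂_nonneg : 0 ≤ γ₂
  γ₂_lt : γ₂ < 2
  κ_pos : 0 < κ
  lt_γ₁ : (d : ℝ) / 2 + s < γ₁
  lt_γ₂ : (d : ℝ) / 2 + σ < γ₂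
  eq_κ₁ : 2 - γ₁ - p = κ
  eq_κ₂ : -s + σ + (2 - γ₂ - p) = κ

lemma exists_admissible {k : ℕ}
    (hdk : ((d = 1 ∨ d = 2 ∨ d = 3) ∧ k = 2) ∨ (d = 1 ∧ k = 3))
    (hs1 : (d : ℝ) * (1 / 2 - 1 / (k : ℝ)) - 1 / (k : ℝ) < s) (hs2 : s ≤ 0) :
    ∃ γ₁ γ₂ κ, Admissible d (sobolevExponent d k) s (k * (sobolevExponent d k - s)) γ₁ γ₂ κ := by
  set σ := sobolevExponent d k with hσ
  set θ := 2 - (d : ℝ) / 2 - s - k * (σ - s) with hθ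
  refine ⟨d / 2 + s + θ / 8, d / 2 + σ + θ / 8, θ - θ / 8, ?_⟩
  unfold sobolevExponent at hσ
  rcases hdk with ⟨h | h | h, rfl⟩ | ⟨rfl, rfl⟩ <;> (try subst h) <;> norm_num at hσ hs1 hθ <;>
    constructor <;> norm_num [hσ, hθ] <;> linarith

/-- The pointwise bounds satisfied by Duhamel terms. -/
structure KernelBound (d : ℕ) (σ s γ₁ γ₂ T A : ℝ) (w : ℝ → Edim d → ℂ) : Prop where
  low : ∀ t ∈ Icc 0 T, ∀ ξ, ‖w t ξ‖ ≤ A * bracket d (-γ₁) ξ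
  high : ∀ t ∈ Ioo 0 T, ∀ ξ, t ^ (-s + σ) * ‖w t ξ‖ ≤ A * bracket d (-γ₂) ξ

/-- The constant in the pointwise bounds for Duhamel terms. -/
def kernelConst (p γ₁ γ₂ : ℝ) : ℝ := 8 * (betaConst (1 - γ₁) (-p) + betaConst (1 - γ₂) (-p))

lemma kernelConst_nonneg (p γ₁ γ₂ : ℝ) : 0 ≤ kernelConst p γ₁ γ₂ :=
  mul_nonneg (by norm_num) (add_nonneg (betaConst_nonneg _ _) (betaConst_nonneg _ _))

lemma SourceBound.kernelBound {M : ℝ} {n : ℝ → Edim d → ℂ} (h : SourceBound d T p M n)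
    (e : Admissible d σ s p γ₁ γ₂ κ) (hM : 0 ≤ M) (hT : 0 ≤ T) (hT1 : T ≤ 1) :
    KernelBound d σ s γ₁ γ₂ T (kernelConst p γ₁ γ₂ * M * T ^ κ) (duhamel d T n) := by
  have hb₁ := betaConst_nonneg (1 - γ₁) (-p)
  have hb₂ := betaConst_nonneg (1 - γ₂) (-p)
  have key : ∀ b c ξ, 0 ≤ b → 8 * b ≤ kernelConst p γ₁ γ₂ → ∀ t ∈ Icc 0 T,
      8 * M * b * t ^ κ * bracket d c ξ ≤ kernelConst p γ₁ γ₂ * M * T ^ κ * bracket d c ξ := by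
    intro b c ξ hb hbc t ht
    have h1 : t ^ κ ≤ T ^ κ := Real.rpow_le_rpow ht.1 ht.2 e.κ_pos.le
    have h2 : 8 * M * b ≤ kernelConst p γ₁ γ₂ * M := by nlinarith
    have h3 := kernelConst_nonneg p γ₁ γ₂
    exact mul_le_mul_of_nonneg_right
      (mul_le_mul h2 h1 (Real.rpow_nonneg ht.1 _) (by positivity)) (bracket_pos c ξ).le
  constructor
  · intro t ht ξ
    rcases ht.1.eq_or_lt with rfl | h0
    · rw [duhamel_zero_time hT, norm_zero]
      have := bracket_pos (-γ₁) ξ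
      have := kernelConst_nonneg p γ₁ γ₂
      positivity
    · refine (h.norm_duhamel_le e.p_lt hT1 e.γ₁_nonneg e.γ₁_lt ⟨h0, ht.2⟩ ξ).trans ?_
      rw [e.eq_κ₁]
      exact key _ _ ξ hb₁ (by unfold kernelConst; linarith) t ht
  · intro t ht ξ
    have h1 := h.norm_duhamel_le e.p_lt hT1 e.γ₂_nonneg e.γ₂_lt ⟨ht.1, ht.2.le⟩ ξ
    refine (mul_le_mul_of_nonneg_left h1 (Real.rpow_nonneg ht.1.le (-s + σ))).trans ?_
    refine le_trans (le_of_eq ?_)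
      (key _ (-γ₂) ξ hb₂ (by unfold kernelConst; linarith) t ⟨ht.1.le, ht.2.le⟩)
    rw [← e.eq_κ₂, Real.rpow_add ht.1 (-s + σ)]
    ring

/-- The constant converting pointwise bounds into a smoothing norm bound. -/
def normConst (d : ℕ) (σ s γ₁ γ₂ : ℝ) : ℝ :=
  (HsNorm d s fun ξ => ((bracket d (-γ₁) ξ : ℝ) : ℂ)).toReal +
    (HsNorm d σ fun ξ => ((bracket d (-γ₂) ξ : ℝ) : ℂ)).toReal

lemma normConst_nonneg (d : ℕ) (σ s γ₁ γ₂ : ℝ) : 0 ≤ normConst d σ s γ₁ γ₂ :=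
  add_nonneg ENNReal.toReal_nonneg ENNReal.toReal_nonneg

variable {A : ℝ} {w : ℝ → Edim d → ℂ}

lemma norm_mul_bracket (hA : 0 ≤ A) (γ : ℝ) (ξ : Edim d) :
    ‖(A : ℂ) * ((bracket d γ ξ : ℝ) : ℂ)‖ = A * bracket d γ ξ := by
  rw [norm_mul, Complex.norm_real, Complex.norm_real, Real.norm_of_nonneg hA,
    Real.norm_of_nonneg (bracket_pos γ ξ).le]

lemma KernelBound.smoothingNorm_le (h : KernelBound d σ s γ₁ γ₂ T A w)
    (e : Admissible d σ s p γ₁ γ₂ κ) (hA : 0 ≤ A) :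
    smoothingNorm d σ s T w ≤ ENNReal.ofReal (normConst d σ s γ₁ γ₂ * A) := by
  have f₁ := (HsNorm_bracket_lt_top e.lt_γ₁).ne
  have f₂ := (HsNorm_bracket_lt_top e.lt_γ₂).ne
  have : ENNReal.ofReal (normConst d σ s γ₁ γ₂ * A) =
      HsNorm d s (fun ξ => (A : ℂ) * ((bracket d (-γ₁) ξ : ℝ) : ℂ)) +
      HsNorm d σ (fun ξ => (A : ℂ) * ((bracket d (-γ₂) ξ : ℝ) : ℂ)) := by
    rw [HsNorm_const_mul hA, HsNorm_const_mul hA, ← mul_add, mul_comm, ENNReal.ofReal_mul hA,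
      normConst, ENNReal.ofReal_add ENNReal.toReal_nonneg ENNReal.toReal_nonneg,
      ENNReal.ofReal_toReal f₁, ENNReal.ofReal_toReal f₂]
  rw [this]
  refine _root_.smoothingNorm_le (fun t ht => HsNorm_mono fun ξ => ?_)
    fun t ht => HdotNorm_le_HsNorm (fun ξ => ?_) (Real.rpow_nonneg ht.1.le _)
  · rw [norm_mul_bracket hA]
    exact h.low t ht ξ
  · rw [norm_mul_bracket hA]
    have h1 := h.high t ht ξ
    have h2 := norm_rpow_le_bracket e.σ_nonneg ξ
    calc _ = ‖ξ‖ ^ σ * (t ^ (-s + σ) * ‖w t ξ‖) := by ring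
      _ ≤ _ := mul_le_mul h2 h1 (mul_nonneg (Real.rpow_nonneg ht.1.le _) (norm_nonneg _))
        (bracket_pos _ _).le

lemma SourceBound.hsContinuousOn_duhamel {M : ℝ} {n : ℝ → Edim d → ℂ}
    (h : SourceBound d T p M n) (e : Admissible d σ s p γ₁ γ₂ κ) (hM : 0 ≤ M) (hT : 0 ≤ T)
    (hT1 : T ≤ 1) : HsContinuousOn d s (Icc 0 T) (duhamel d T n) := by
  have hK := h.kernelBound e hM hT hT1
  have hA : 0 ≤ kernelConst p γ₁ γ₂ * M * T ^ κ := by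
    have := kernelConst_nonneg p γ₁ γ₂
    positivity
  refine hsContinuousOn_of_dominated
    (G := fun ξ => ((kernelConst p γ₁ γ₂ * M * T ^ κ : ℝ) : ℂ) * ((bracket d (-γ₁) ξ : ℝ) : ℂ))
    (fun t _ => ?_) ?_ (fun t ht ξ => ?_) (fun ξ => h.continuousOn_duhamel e.p_lt hT1 hT ξ)
  · have := (measurable_duhamel h.measurable T).comp (measurable_prodMk_left (x := t))
    simpa only [Function.comp_def] using this
  · rw [HsNorm_const_mul hA]
    exact ENNReal.mul_lt_top ENNReal.ofReal_lt_top (HsNorm_bracket_lt_top e.lt_γ₁)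
  · rw [norm_mul_bracket hA]
    exact hK.low t ht ξ

end KernelBounds

section Source

variable {d k : ℕ} {s T : ℝ}

/-- The source term `u ↦ \widehat{u^k}`. -/
def powerSource (d k : ℕ) (u : ℝ → Edim d → ℂ) (t : ℝ) : Edim d → ℂ := convIter d (u t) (k - 1)

lemma HdotNorm_le_of_smoothingNorm_le {σ B : ℝ} {u : ℝ → Edim d → ℂ}
    (h : smoothingNorm d σ s T u ≤ ENNReal.ofReal B) {t : ℝ} (ht : t ∈ Ioo 0 T) :
    HdotNorm d σ (u t) ≤ ENNReal.ofReal (B * t ^ (-(σ - s))) := by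
  have h1 := (HdotNorm_le_smoothingNorm u ht).trans h
  have h0 : 0 < t ^ (-s + σ) := Real.rpow_pos_of_pos ht.1 _
  rw [show -(σ - s) = -(-s + σ) by ring, Real.rpow_neg ht.1.le, ← div_eq_mul_inv,
    ENNReal.ofReal_div_of_pos h0]
  rw [ENNReal.le_div_iff_mul_le (Or.inl (by simpa using h0)) (Or.inl ENNReal.ofReal_ne_top),
    mul_comm]
  exact h1

lemma measurable_slice {u : ℝ → Edim d → ℂ} (hu : Measurable fun z : ℝ × Edim d => u z.1 z.2)
    (t : ℝ) : Measurable (u t) := by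
  have := hu.comp (measurable_prodMk_left (x := t))
  simpa only [Function.comp_def] using this

lemma HdotNorm_zero_lt_top_of_smoothingNorm {σ : ℝ} (hs : s ≤ 0) (hσ : 0 ≤ σ)
    {u : ℝ → Edim d → ℂ} (hu : Measurable fun z : ℝ × Edim d => u z.1 z.2)
    (h : smoothingNorm d σ s T u < ⊤) {t : ℝ} (ht : t ∈ Ioo 0 T) : HdotNorm d 0 (u t) < ⊤ := by
  refine HdotNorm_zero_lt_top hs hσ
    (HsNorm_lt_top_iff.1 ((HsNorm_le_smoothingNorm u ⟨ht.1.le, ht.2.le⟩).trans_lt h)) ?_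
    (measurable_slice hu t)
  have := HdotNorm_le_of_smoothingNorm_le (ENNReal.ofReal_toReal h.ne).ge ht
  exact this.trans_lt ENNReal.ofReal_lt_top

lemma exists_sourceBound_sub
    (hdk : ((d = 1 ∨ d = 2 ∨ d = 3) ∧ k = 2) ∨ (d = 1 ∧ k = 3)) (hs2 : s ≤ 0) :
    ∃ c : ℝ, 0 ≤ c ∧ ∀ {T B X : ℝ} {u v : ℝ → Edim d → ℂ}, 0 ≤ B → 0 ≤ X →
      (Measurable fun z : ℝ × Edim d => u z.1 z.2) →
      (Measurable fun z : ℝ × Edim d => v z.1 z.2) →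
      smoothingNorm d (sobolevExponent d k) s T u ≤ ENNReal.ofReal B →
      smoothingNorm d (sobolevExponent d k) s T v ≤ ENNReal.ofReal B →
      smoothingNorm d (sobolevExponent d k) s T (fun t ξ => u t ξ - v t ξ) ≤ ENNReal.ofReal X →
      SourceBound d T (k * (sobolevExponent d k - s)) (c * B ^ (k - 1) * X)
        (fun t ξ => powerSource d k u t ξ - powerSource d k v t ξ) := by
  obtain ⟨c, hc⟩ := enorm_convIter_sub_le hdk
  have hσ : 0 ≤ sobolevExponent d k := by
    unfold sobolevExponent
    rcases hdk with ⟨-, rfl⟩ | ⟨rfl, rfl⟩ <;> norm_num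
  have hk : 1 ≤ k := by omega
  refine ⟨c, c.2, fun {T B X u v} hB hX hu hv hBu hBv hXuv =>
    ⟨(measurable_convIter hu _).sub (measurable_convIter hv _), fun t ht ξ => ?_⟩⟩
  have hc0 := NNReal.coe_nonneg c
  set r := t ^ (-(sobolevExponent d k - s)) with hr
  have hr0 : 0 ≤ r := Real.rpow_nonneg ht.1.le _
  have h1 := hc (measurable_slice hu t) (measurable_slice hv t)
    (HdotNorm_zero_lt_top_of_smoothingNorm hs2 hσ hu (hBu.trans_lt ENNReal.ofReal_lt_top) ht)
    (HdotNorm_zero_lt_top_of_smoothingNorm hs2 hσ hv (hBv.trans_lt ENNReal.ofReal_lt_top) ht)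
    ENNReal.ofReal_lt_top (HdotNorm_le_of_smoothingNorm_le hBu ht)
    (HdotNorm_le_of_smoothingNorm_le hBv ht) ξ
  have h2 := h1.trans (mul_le_mul_right (HdotNorm_le_of_smoothingNorm_le hXuv ht) _)
  rw [← ENNReal.ofReal_coe_nnreal, ← ENNReal.ofReal_pow (mul_nonneg hB hr0),
    ← ENNReal.ofReal_mul (NNReal.coe_nonneg c), ← ENNReal.ofReal_mul (by positivity), ← ofReal_norm,
    ENNReal.ofReal_le_ofReal_iff (by positivity)] at h2
  refine h2.trans (le_of_eq ?_)
  have h3 : t ^ (-(k * (sobolevExponent d k - s))) = r ^ (k - 1) * r := by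
    rw [← pow_succ, Nat.sub_add_cancel hk, hr, ← Real.rpow_mul_natCast ht.1.le]
    ring_nf
  rw [h3, mul_pow]
  ring

end Source

section Contraction

variable {d k : ℕ} {s p γ₁ γ₂ κ T B X : ℝ}

/-- The contraction hypothesis: the Duhamel term of a difference of source terms obeys kernel
bounds with a small constant. -/
structure Contractive (d k : ℕ) (s p γ₁ γ₂ T B : ℝ) (μ : ℝ) : Prop where
  sub : ∀ {X : ℝ} {u v : ℝ → Edim d → ℂ}, 0 ≤ X →
    (Measurable fun z : ℝ × Edim d => u z.1 z.2) →
    (Measurable fun z : ℝ × Edim d => v z.1 z.2) →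
    smoothingNorm d (sobolevExponent d k) s T u ≤ ENNReal.ofReal B →
    smoothingNorm d (sobolevExponent d k) s T v ≤ ENNReal.ofReal B →
    smoothingNorm d (sobolevExponent d k) s T (fun t ξ => u t ξ - v t ξ) ≤ ENNReal.ofReal X →
    KernelBound d (sobolevExponent d k) s γ₁ γ₂ T (μ * X)
      (fun t ξ => duhamel d T (powerSource d k u) t ξ - duhamel d T (powerSource d k v) t ξ)
  exists_source_bound : ∀ {u : ℝ → Edim d → ℂ}, (Measurable fun z : ℝ × Edim d => u z.1 z.2) →
    smoothingNorm d (sobolevExponent d k) s T u ≤ ENNReal.ofReal B →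
    ∃ M, 0 ≤ M ∧ SourceBound d T p M (powerSource d k u)
  nonneg : 0 ≤ μ
  small : normConst d (sobolevExponent d k) s γ₁ γ₂ * μ ≤ 1 / 2

lemma smoothingNorm_zero (d : ℕ) (σ s T : ℝ) :
    smoothingNorm d σ s T (fun _ _ => 0) = 0 := by
  refine nonpos_iff_eq_zero.1 ((smoothingNorm_le (a := 0) (b := 0) (fun t _ => ?_)
    fun t _ => ?_).trans (by simp))
  · exact (HsNorm_zero s).le
  · rw [HdotNorm_zero, mul_zero]

lemma powerSource_zero (t : ℝ) (ξ : Edim d) : powerSource d k (fun _ _ => 0) t ξ = 0 := by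
  rw [powerSource, convIter_zero_fun]

lemma exists_contractive
    (hdk : ((d = 1 ∨ d = 2 ∨ d = 3) ∧ k = 2) ∨ (d = 1 ∧ k = 3))
    (e : Admissible d (sobolevExponent d k) s (k * (sobolevExponent d k - s)) γ₁ γ₂ κ)
    (hB : 0 ≤ B) :
    ∃ T ∈ Ioo (0 : ℝ) 1, ∃ μ,
      Contractive d k s (k * (sobolevExponent d k - s)) γ₁ γ₂ T B μ := by
  obtain ⟨c, hc0, hc⟩ := exists_sourceBound_sub hdk e.s_nonpos
  set N := normConst d (sobolevExponent d k) s γ₁ γ₂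
  set p := (k : ℝ) * (sobolevExponent d k - s)
  set D := kernelConst p γ₁ γ₂ * (c * B ^ (k - 1)) with hD
  have hN : 0 ≤ N := normConst_nonneg _ _ _ _ _
  have hK : 0 ≤ kernelConst p γ₁ γ₂ := kernelConst_nonneg _ _ _
  have hlim : Tendsto (fun T : ℝ => N * (D * T ^ κ)) (𝓝[>] 0) (𝓝 0) := by
    have h1 : Tendsto (fun T : ℝ => T ^ κ) (𝓝[>] 0) (𝓝 0) := by
      have := (Real.continuousAt_rpow_const 0 κ (Or.inr e.κ_pos.le)).tendsto
      rw [Real.zero_rpow e.κ_pos.ne'] at this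
      exact this.mono_left nhdsWithin_le_nhds
    simpa using (h1.const_mul D).const_mul N
  obtain ⟨T, hT2, hT⟩ := ((hlim.eventually (ge_mem_nhds (show (0 : ℝ) < 1 / 2 by norm_num))).and
    (Ioo_mem_nhdsGT zero_lt_one)).exists
  have hsrc : ∀ {u : ℝ → Edim d → ℂ}, (Measurable fun z : ℝ × Edim d => u z.1 z.2) →
      smoothingNorm d (sobolevExponent d k) s T u ≤ ENNReal.ofReal B →
      ∃ M, 0 ≤ M ∧ SourceBound d T p M (powerSource d k u) := by
    intro u hu hBu
    refine ⟨c * B ^ (k - 1) * B, by positivity, ?_⟩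
    have := hc (v := fun _ _ => 0) hB hB hu measurable_const hBu
      (by rw [smoothingNorm_zero]; exact zero_le) (by simpa using hBu)
    simpa only [powerSource_zero, sub_zero] using this
  refine ⟨T, hT, D * T ^ κ, ⟨fun {X u v} hX hu hv hBu hBv hXuv => ?_, hsrc, ?_, hT2⟩⟩
  · have h1 := (hc hB hX hu hv hBu hBv hXuv).kernelBound e (by positivity) hT.1.le hT.2.le
    obtain ⟨M, -, hM⟩ := hsrc hu hBu
    obtain ⟨M', -, hM'⟩ := hsrc hv hBv
    have e1 : kernelConst p γ₁ γ₂ * (c * B ^ (k - 1) * X) * T ^ κ = D * T ^ κ * X := by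
      rw [hD]; ring
    rw [e1] at h1
    refine ⟨fun t ht ξ => ?_, fun t ht ξ => ?_⟩
    · rw [duhamel_sub hM hM' e.p_lt hT.2.le ht]
      exact h1.low t ht ξ
    · rw [duhamel_sub hM hM' e.p_lt hT.2.le ⟨ht.1.le, ht.2.le⟩]
      exact h1.high t ht ξ
  · have := hT.1
    positivity

end Contraction

section Picard

variable {d k : ℕ} {σ s p γ₁ γ₂ κ T A A' B μ : ℝ} {w w' : ℝ → Edim d → ℂ}

lemma KernelBound.mono (h : KernelBound d σ s γ₁ γ₂ T A w) (hA : A ≤ A')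
    (hw : ∀ t ∈ Icc 0 T, ∀ ξ, ‖w' t ξ‖ ≤ ‖w t ξ‖) : KernelBound d σ s γ₁ γ₂ T A' w' where
  low t ht ξ := (hw t ht ξ).trans <| (h.low t ht ξ).trans <|
    mul_le_mul_of_nonneg_right hA (bracket_pos _ ξ).le
  high t ht ξ := (mul_le_mul_of_nonneg_left (hw t ⟨ht.1.le, ht.2.le⟩ ξ)
    (Real.rpow_nonneg ht.1.le _)).trans <| (h.high t ht ξ).trans <|
    mul_le_mul_of_nonneg_right hA (bracket_pos _ ξ).le

/-- The Picard iteration with free evolution `V`. -/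
def picard (d k : ℕ) (T : ℝ) (V : ℝ → Edim d → ℂ) : ℕ → ℝ → Edim d → ℂ
  | 0 => V
  | n + 1 => fun t ξ => V t ξ - duhamel d T (powerSource d k (picard d k T V n)) t ξ

lemma duhamel_powerSource_zero (t : ℝ) (ξ : Edim d) :
    duhamel d T (powerSource d k fun _ _ => 0) t ξ = 0 := by
  simp [duhamel, powerSource_zero]

lemma Contractive.kernelBound (h : Contractive d k s p γ₁ γ₂ T B μ) (hB : 0 ≤ B)
    {u : ℝ → Edim d → ℂ} (hu : Measurable fun z : ℝ × Edim d => u z.1 z.2)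
    (hBu : smoothingNorm d (sobolevExponent d k) s T u ≤ ENNReal.ofReal B) :
    KernelBound d (sobolevExponent d k) s γ₁ γ₂ T (μ * B) (duhamel d T (powerSource d k u)) := by
  have := h.sub (v := fun _ _ => 0) hB hu measurable_const hBu
    (by rw [smoothingNorm_zero]; exact zero_le) (by simpa using hBu)
  simpa only [duhamel_powerSource_zero, sub_zero] using this

lemma measurable_powerSource {u : ℝ → Edim d → ℂ} (hu : Measurable fun z : ℝ × Edim d => u z.1 z.2) :
    Measurable fun z : ℝ × Edim d => powerSource d k u z.1 z.2 := measurable_convIter hu _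

variable {V : ℝ → Edim d → ℂ}

lemma measurable_picard (hV : Measurable fun z : ℝ × Edim d => V z.1 z.2) (n : ℕ) :
    Measurable fun z : ℝ × Edim d => picard d k T V n z.1 z.2 := by
  induction n with
  | zero => exact hV
  | succ n ih => exact hV.sub (measurable_duhamel (measurable_powerSource ih) T)

lemma smoothingNorm_add_kernelBound_le (e : Admissible d σ s p γ₁ γ₂ κ)
    (hV : Measurable fun z : ℝ × Edim d => V z.1 z.2)
    (hwm : Measurable fun z : ℝ × Edim d => w z.1 z.2) (hA : 0 ≤ A)
    (hw : KernelBound d σ s γ₁ γ₂ T A w) {b : ℝ} (hb : 0 ≤ b)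
    (hVb : smoothingNorm d σ s T V ≤ ENNReal.ofReal b) :
    smoothingNorm d σ s T (fun t ξ => V t ξ + w t ξ) ≤
      ENNReal.ofReal (b + normConst d σ s γ₁ γ₂ * A) := by
  rw [ENNReal.ofReal_add hb (mul_nonneg (normConst_nonneg _ _ _ _ _) hA)]
  exact (smoothingNorm_add_le (fun t _ => measurable_slice hV t)
    fun t _ => measurable_slice hwm t).trans (add_le_add hVb (hw.smoothingNorm_le e hA))

lemma Contractive.smoothingNorm_picard_le (h : Contractive d k s p γ₁ γ₂ T B μ)
    (e : Admissible d (sobolevExponent d k) s p γ₁ γ₂ κ) (hB : 0 ≤ B)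
    (hV : Measurable fun z : ℝ × Edim d => V z.1 z.2)
    (hVb : smoothingNorm d (sobolevExponent d k) s T V ≤ ENNReal.ofReal (B / 2)) (n : ℕ) :
    smoothingNorm d (sobolevExponent d k) s T (picard d k T V n) ≤ ENNReal.ofReal B := by
  induction n with
  | zero => exact hVb.trans (ENNReal.ofReal_le_ofReal (by linarith))
  | succ n ih =>
    have hm := measurable_picard (k := k) (T := T) hV n
    have h1 := (h.kernelBound hB hm ih).mono le_rfl
      (w' := fun t ξ => -duhamel d T (powerSource d k (picard d k T V n)) t ξ)
      fun t _ ξ => (norm_neg _).le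
    have h2 := smoothingNorm_add_kernelBound_le e hV
      (measurable_duhamel (measurable_powerSource hm) T).neg (mul_nonneg h.nonneg hB) h1
      (by linarith) hVb
    simp only [← sub_eq_add_neg] at h2
    refine h2.trans (ENNReal.ofReal_le_ofReal ?_)
    nlinarith [h.small]

lemma Contractive.kernelBound_picard (h : Contractive d k s p γ₁ γ₂ T B μ)
    (e : Admissible d (sobolevExponent d k) s p γ₁ γ₂ κ) (hB : 0 ≤ B)
    (hV : Measurable fun z : ℝ × Edim d => V z.1 z.2)
    (hVb : smoothingNorm d (sobolevExponent d k) s T V ≤ ENNReal.ofReal (B / 2)) (n : ℕ) :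
    KernelBound d (sobolevExponent d k) s γ₁ γ₂ T (μ * B * (1 / 2) ^ n)
      (fun t ξ => picard d k T V (n + 1) t ξ - picard d k T V n t ξ) := by
  have hμB := mul_nonneg h.nonneg hB
  induction n with
  | zero =>
    refine (h.kernelBound hB hV (hVb.trans (ENNReal.ofReal_le_ofReal (by linarith)))).mono
      (by simp) fun t _ ξ => ?_
    simp [picard]
  | succ n ih =>
    have hA : 0 ≤ μ * B * (1 / 2) ^ n := by positivity
    have h1 := h.sub (mul_nonneg (normConst_nonneg _ _ _ _ _) hA)
      (measurable_picard (k := k) (T := T) hV (n + 1)) (measurable_picard (k := k) (T := T) hV n)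
      (h.smoothingNorm_picard_le e hB hV hVb (n + 1)) (h.smoothingNorm_picard_le e hB hV hVb n)
      (ih.smoothingNorm_le e hA)
    refine h1.mono ?_ fun t _ ξ => ?_
    · rw [pow_succ]
      nlinarith [h.small]
    · rw [← norm_neg]
      simp [picard]

lemma KernelBound.of_tendsto {f : ℕ → ℝ → Edim d → ℂ} {u : ℝ → Edim d → ℂ}
    (h : ∀ n, KernelBound d σ s γ₁ γ₂ T (A * (1 / 2) ^ n) fun t ξ => f (n + 1) t ξ - f n t ξ)
    (hf : ∀ t ∈ Icc 0 T, ∀ ξ, Tendsto (fun n => f n t ξ) atTop (𝓝 (u t ξ))) (n : ℕ) :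
    KernelBound d σ s γ₁ γ₂ T (2 * A * (1 / 2) ^ n) fun t ξ => u t ξ - f n t ξ := by
  constructor
  · intro t ht ξ
    have := dist_le_of_le_geometric_of_tendsto (1 / 2) (A * bracket d (-γ₁) ξ) (by norm_num)
      (fun n => by
        rw [dist_comm, dist_eq_norm]
        exact ((h n).low t ht ξ).trans_eq (by ring)) (hf t ht ξ) n
    rw [dist_comm, dist_eq_norm] at this
    exact this.trans_eq (by ring)
  · intro t ht ξ
    have h0 : 0 < t ^ (-s + σ) := Real.rpow_pos_of_pos ht.1 _
    have := dist_le_of_le_geometric_of_tendsto (1 / 2) (A * bracket d (-γ₂) ξ / t ^ (-s + σ))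
      (by norm_num) (fun n => by
        have := (h n).high t ht ξ
        rw [dist_comm, dist_eq_norm, div_mul_eq_mul_div, le_div_iff₀ h0, mul_comm]
        exact this.trans_eq (by ring)) (hf t ⟨ht.1.le, ht.2.le⟩ ξ) n
    rw [dist_comm, dist_eq_norm] at this
    refine (mul_le_mul_of_nonneg_left this h0.le).trans_eq ?_
    field_simp
    ring

lemma exists_limit {f : ℕ → ℝ → Edim d → ℂ}
    (hm : ∀ n, Measurable fun z : ℝ × Edim d => f n z.1 z.2)
    (h : ∀ n, KernelBound d σ s γ₁ γ₂ T (A * (1 / 2) ^ n) fun t ξ => f (n + 1) t ξ - f n t ξ) :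
    ∃ u : ℝ → Edim d → ℂ, (Measurable fun z : ℝ × Edim d => u z.1 z.2) ∧
      ∀ t ∈ Icc 0 T, ∀ ξ, Tendsto (fun n => f n t ξ) atTop (𝓝 (u t ξ)) := by
  classical
  have hlim : ∀ t ξ, ∃ l, Tendsto (fun n => if t ∈ Icc 0 T then f n t ξ else 0) atTop (𝓝 l) := by
    intro t ξ
    by_cases ht : t ∈ Icc 0 T
    · simp only [if_pos ht]
      exact cauchySeq_tendsto_of_complete <|
        cauchySeq_of_le_geometric (1 / 2) (A * bracket d (-γ₁) ξ) (by norm_num) fun n => by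
          rw [dist_comm, dist_eq_norm]
          exact ((h n).low t ht ξ).trans_eq (by ring)
    · simp only [if_neg ht]
      exact ⟨0, tendsto_const_nhds⟩
  choose u hu using hlim
  refine ⟨u, measurable_of_tendsto_metrizable
    (f := fun n (z : ℝ × Edim d) => if z.1 ∈ Icc 0 T then f n z.1 z.2 else 0)
    (fun n => ?_) (tendsto_pi_nhds.2 fun z => hu z.1 z.2), fun t ht ξ => ?_⟩
  · exact Measurable.ite (measurable_fst measurableSet_Icc) (hm n) measurable_const
  · simpa only [if_pos ht] using hu t ξ

lemma tendsto_of_kernelBound {f : ℕ → ℝ → Edim d → ℂ} {u : ℝ → Edim d → ℂ}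
    (h : ∀ n, KernelBound d σ s γ₁ γ₂ T (A * (1 / 2) ^ n) fun t ξ => f n t ξ - u t ξ)
    {t : ℝ} (ht : t ∈ Icc 0 T) (ξ : Edim d) : Tendsto (fun n => f n t ξ) atTop (𝓝 (u t ξ)) := by
  rw [tendsto_iff_norm_sub_tendsto_zero]
  refine squeeze_zero (fun n => norm_nonneg _) (fun n => (h n).low t ht ξ) ?_
  have := ((tendsto_pow_atTop_nhds_zero_of_lt_one (r := (1 / 2 : ℝ)) (by norm_num)
    (by norm_num)).const_mul A).mul_const (bracket d (-γ₁) ξ)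
  simpa using this

/-- Existence of a fixed point of the Duhamel map. -/
lemma Contractive.exists_fixed_point (h : Contractive d k s p γ₁ γ₂ T B μ)
    (e : Admissible d (sobolevExponent d k) s p γ₁ γ₂ κ) (hB : 0 ≤ B)
    (hV : Measurable fun z : ℝ × Edim d => V z.1 z.2)
    (hVb : smoothingNorm d (sobolevExponent d k) s T V ≤ ENNReal.ofReal (B / 2)) :
    ∃ u : ℝ → Edim d → ℂ, (Measurable fun z : ℝ × Edim d => u z.1 z.2) ∧
      smoothingNorm d (sobolevExponent d k) s T u ≤ ENNReal.ofReal B ∧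
      ∀ t ∈ Icc 0 T, ∀ ξ, u t ξ = V t ξ - duhamel d T (powerSource d k u) t ξ := by
  set N := normConst d (sobolevExponent d k) s γ₁ γ₂
  have hN : 0 ≤ N := normConst_nonneg _ _ _ _ _
  have hμB := mul_nonneg h.nonneg hB
  have hm := measurable_picard (k := k) (T := T) hV
  have hnorm := h.smoothingNorm_picard_le e hB hV hVb
  have hstep := h.kernelBound_picard e hB hV hVb
  obtain ⟨u, hum, hu⟩ := exists_limit hm hstep
  have hdiff := KernelBound.of_tendsto hstep hu
  have hA : ∀ n : ℕ, 0 ≤ 2 * (μ * B) * (1 / 2) ^ n := fun n => by positivity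
  have huB : smoothingNorm d (sobolevExponent d k) s T u ≤ ENNReal.ofReal B := by
    have h1 : ∀ n : ℕ, smoothingNorm d (sobolevExponent d k) s T u ≤
        ENNReal.ofReal (B + N * (2 * (μ * B) * (1 / 2) ^ n)) := fun n => by
      have := smoothingNorm_add_kernelBound_le e (hm n) (hum.sub (hm n)) (hA n) (hdiff n) hB
        (hnorm n)
      simpa only [add_sub_cancel] using this
    have h2 : Tendsto (fun n : ℕ => B + N * (2 * (μ * B) * (1 / 2) ^ n)) atTop (𝓝 B) := by
      have := (((tendsto_pow_atTop_nhds_zero_of_lt_one (r := (1 / 2 : ℝ)) (by norm_num)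
        (by norm_num)).const_mul (2 * (μ * B))).const_mul N).const_add B
      simpa using this
    exact ge_of_tendsto' (ENNReal.tendsto_ofReal h2) h1
  refine ⟨u, hum, huB, fun t ht ξ => ?_⟩
  have hd : ∀ n, KernelBound d (sobolevExponent d k) s γ₁ γ₂ T
      (μ * (N * (2 * (μ * B))) * (1 / 2) ^ n) fun t ξ =>
        duhamel d T (powerSource d k (picard d k T V n)) t ξ - duhamel d T (powerSource d k u) t ξ := by
    intro n
    refine (h.sub (mul_nonneg hN (hA n)) hum (hm n) huB (hnorm n)
      ((hdiff n).smoothingNorm_le e (hA n))).mono (le_of_eq (by ring)) fun t _ ξ => ?_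
    rw [norm_sub_rev]
  exact tendsto_nhds_unique ((hu t ht ξ).comp (tendsto_add_atTop_nat 1))
    ((tendsto_of_kernelBound hd ht ξ).const_sub (V t ξ))

end Picard

section WellPosedness

variable {d k : ℕ} {s p γ₁ γ₂ κ T B μ : ℝ}

lemma measurable_Vflow_uncurried {F₀ F₁ : Edim d → ℂ} (h₀ : Measurable F₀) (h₁ : Measurable F₁) :
    Measurable fun z : ℝ × Edim d => Vflow d F₀ F₁ z.1 z.2 := by
  unfold Vflow Psym V0sym V1sym
  fun_prop

lemma intervalIntegral_convIter_congr {u v : ℝ → Edim d → ℂ} (hk : 2 ≤ k)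
    (h : ∀ t ∈ Icc 0 T, v t =ᵐ[volume] u t) {t : ℝ} (ht : t ∈ Icc 0 T) (ξ : Edim d) :
    ∫ t' in (0 : ℝ)..t, ((Wsym (t - t') ‖ξ‖ : ℝ) : ℂ) * convIter d (u t') (k - 1) ξ =
      duhamel d T (powerSource d k v) t ξ := by
  rw [duhamel_eq_intervalIntegral ht]
  refine intervalIntegral.integral_congr fun t' ht' => ?_
  rw [uIcc_of_le ht.1] at ht'
  obtain ⟨n, rfl⟩ : ∃ n, k = n + 2 := ⟨k - 2, by omega⟩
  simp only [powerSource]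
  rw [show n + 2 - 1 = n + 1 by omega, convIter_congr_ae (h t' ⟨ht'.1, ht'.2.trans ht.2⟩) n]

lemma SolProps.xnorm_le {F₀ F₁ : Edim d → ℂ} {u : ℝ → Edim d → ℂ}
    (h : SolProps d k s T B F₀ F₁ u) :
    smoothingNorm d (sobolevExponent d k) s T u ≤ ENNReal.ofReal B := h.2.2.1

/-- Existence of a solution. -/
lemma Contractive.exists_solution (h : Contractive d k s p γ₁ γ₂ T B μ)
    (e : Admissible d (sobolevExponent d k) s p γ₁ γ₂ κ) (hk : 2 ≤ k) (hB : 0 ≤ B)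
    (hT : T ∈ Ioo (0 : ℝ) 1) {F₀ F₁ : Edim d → ℂ} (h₀ : Measurable F₀) (h₁ : Measurable F₁)
    (hF : 64 * pairHsNorm d s F₀ F₁ ≤ ENNReal.ofReal (B / 2)) :
    ∃ u, SolProps d k s T B F₀ F₁ u := by
  have hFt : pairHsNorm d s F₀ F₁ < ⊤ := by
    refine lt_of_le_of_lt (le_mul_of_one_le_left zero_le (by norm_num))
      (hF.trans_lt ENNReal.ofReal_lt_top)
  obtain ⟨u, hum, huB, hu⟩ := h.exists_fixed_point e hB (measurable_Vflow_uncurried h₀ h₁)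
    ((smoothingNorm_Vflow_le e.σ_nonneg e.s_nonpos e.gap hT.2.le h₀ h₁).trans hF)
  obtain ⟨M, hM0, hM⟩ := h.exists_source_bound hum huB
  have hV := hsContinuousOn_Vflow hT.2.le h₀ h₁ hFt
  have hD := hM.hsContinuousOn_duhamel e hM0 hT.1.le hT.2.le
  have hc := hsContinuousOn_iff.1 (hV.sub hD (fun t _ => measurable_Vflow h₀ h₁ t)
    fun t _ => measurable_slice (measurable_duhamel hM.measurable T) t)
  refine ⟨u, fun t ht => ⟨measurable_slice hum t, HsNorm_lt_top_iff.1
    (((HsNorm_le_smoothingNorm u ht).trans huB).trans_lt ENNReal.ofReal_lt_top)⟩,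
    fun t₀ ht₀ ε hε => ?_, huB, fun t ht => Eventually.of_forall fun ξ => ?_⟩
  · obtain ⟨δ, hδ, hδ'⟩ := hc t₀ ht₀ ε hε
    refine ⟨δ, hδ, fun t ht htt => ?_⟩
    simpa only [hu t ht, hu t₀ ht₀] using hδ' t ht htt
  · rw [intervalIntegral_convIter_congr hk (fun _ _ => ae_eq_rfl) ht, hu t ht ξ, Vflow]

lemma SolProps.exists_measurable_modification {F₀ F₁ : Edim d → ℂ} {u : ℝ → Edim d → ℂ}
    (h : SolProps d k s T B F₀ F₁ u) (hk : 2 ≤ k) (hT : 0 ≤ T) :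
    ∃ v : ℝ → Edim d → ℂ, (Measurable fun z : ℝ × Edim d => v z.1 z.2) ∧
      (∀ t ∈ Icc 0 T, v t =ᵐ[volume] u t) ∧
      smoothingNorm d (sobolevExponent d k) s T v ≤ ENNReal.ofReal B ∧
      ∀ t ∈ Icc 0 T, ∀ᵐ ξ, v t ξ = Vflow d F₀ F₁ t ξ - duhamel d T (powerSource d k v) t ξ := by
  obtain ⟨v, hvm, hv⟩ := HsContinuousOn.exists_measurable_modification hT
    (hsContinuousOn_iff.2 h.2.1) fun t ht => (h.1 t ht).1
  refine ⟨v, hvm, hv, (smoothingNorm_congr_ae hv).trans_le h.xnorm_le, fun t ht => ?_⟩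
  filter_upwards [hv t ht, h.2.2.2 t ht] with ξ h1 h2
  rw [h1, h2, intervalIntegral_convIter_congr hk hv ht, Vflow]

lemma Vflow_sub (F₀ F₁ G₀ G₁ : Edim d → ℂ) (t : ℝ) (ξ : Edim d) :
    Vflow d F₀ F₁ t ξ - Vflow d G₀ G₁ t ξ =
      Vflow d (fun ξ => F₀ ξ - G₀ ξ) (fun ξ => F₁ ξ - G₁ ξ) t ξ := by
  unfold Vflow
  ring

/-- Lipschitz dependence on the data. -/
lemma Contractive.smoothingNorm_sub_le (h : Contractive d k s p γ₁ γ₂ T B μ)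
    (e : Admissible d (sobolevExponent d k) s p γ₁ γ₂ κ) (hk : 2 ≤ k)
    (hT : T ∈ Ioo (0 : ℝ) 1) {F₀ F₁ G₀ G₁ : Edim d → ℂ} (hF₀ : Measurable F₀)
    (hF₁ : Measurable F₁) (hG₀ : Measurable G₀) (hG₁ : Measurable G₁) {u v : ℝ → Edim d → ℂ}
    (hu : SolProps d k s T B F₀ F₁ u) (hv : SolProps d k s T B G₀ G₁ v) :
    smoothingNorm d (sobolevExponent d k) s T (fun t ξ => u t ξ - v t ξ) ≤
      128 * pairHsNorm d s (fun ξ => F₀ ξ - G₀ ξ) (fun ξ => F₁ ξ - G₁ ξ) := by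
  obtain ⟨u', hum, huu, huB, hu'⟩ := hu.exists_measurable_modification hk hT.1.le
  obtain ⟨v', hvm, hvv, hvB, hv'⟩ := hv.exists_measurable_modification hk hT.1.le
  rw [← smoothingNorm_congr_ae (u := fun t ξ => u' t ξ - v' t ξ)
    (v := fun t ξ => u t ξ - v t ξ) fun t ht => (huu t ht).sub (hvv t ht)]
  set S := smoothingNorm d (sobolevExponent d k) s T fun t ξ => u' t ξ - v' t ξ with hS
  set P := pairHsNorm d s (fun ξ => F₀ ξ - G₀ ξ) (fun ξ => F₁ ξ - G₁ ξ)
  have hSt : S ≠ ⊤ := by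
    have h1 : smoothingNorm d (sobolevExponent d k) s T (fun t ξ => -v' t ξ) =
        smoothingNorm d (sobolevExponent d k) s T v' := by
      simp only [smoothingNorm, HsNorm, HsNormSq, HdotNorm, HdotNormSq, norm_neg]
    have h2 := smoothingNorm_add_le (T := T) (d := d) (σ := sobolevExponent d k) (s := s)
      (fun t _ => measurable_slice hum t) (fun t _ => (measurable_slice hvm t).neg)
    simp only [Pi.neg_apply, ← sub_eq_add_neg] at h2
    refine ne_top_of_le_ne_top ?_ h2
    exact ENNReal.add_ne_top.2 ⟨ne_top_of_le_ne_top ENNReal.ofReal_ne_top huB,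
      h1 ▸ ne_top_of_le_ne_top ENNReal.ofReal_ne_top hvB⟩
  have hX : 0 ≤ S.toReal := ENNReal.toReal_nonneg
  have hK := (h.sub hX hum hvm huB hvB (ENNReal.ofReal_toReal hSt).ge).mono le_rfl
    (w' := fun t ξ => -(duhamel d T (powerSource d k u') t ξ -
      duhamel d T (powerSource d k v') t ξ)) fun t _ ξ => (norm_neg _).le
  have hD : smoothingNorm d (sobolevExponent d k) s T _ ≤ _ :=
    hK.smoothingNorm_le e (mul_nonneg h.nonneg hX)
  have hV := smoothingNorm_Vflow_le e.σ_nonneg e.s_nonpos e.gap hT.2.le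
    (hF₀.sub hG₀) (hF₁.sub hG₁)
  have key : S ≤ 64 * P + 2⁻¹ * S := by
    have e1 : S = smoothingNorm d (sobolevExponent d k) s T fun t ξ =>
        Vflow d (fun ξ => F₀ ξ - G₀ ξ) (fun ξ => F₁ ξ - G₁ ξ) t ξ +
          -(duhamel d T (powerSource d k u') t ξ - duhamel d T (powerSource d k v') t ξ) := by
      refine smoothingNorm_congr_ae fun t ht => ?_
      filter_upwards [hu' t ht, hv' t ht] with ξ h1 h2
      rw [h1, h2, ← Vflow_sub]
      ring
    conv_lhs => rw [e1]
    refine (smoothingNorm_add_le (fun t _ => measurable_Vflow (hF₀.sub hG₀) (hF₁.sub hG₁) t)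
      fun t _ => ((measurable_slice (measurable_duhamel (measurable_powerSource hum) T) t).sub
        (measurable_slice (measurable_duhamel (measurable_powerSource hvm) T) t)).neg).trans
      (add_le_add hV (hD.trans ?_))
    calc _ ≤ ENNReal.ofReal (2⁻¹ * S.toReal) :=
          ENNReal.ofReal_le_ofReal (by nlinarith [h.small])
      _ = 2⁻¹ * S := by
        rw [ENNReal.ofReal_mul (by norm_num), ENNReal.ofReal_toReal hSt,
          ENNReal.ofReal_inv_of_pos (by norm_num)]
        norm_num
  have h2 : 2⁻¹ * S ≤ 64 * P := by
    have e2 : S = 2⁻¹ * S + 2⁻¹ * S := by rw [← add_mul, ENNReal.inv_two_add_inv_two, one_mul]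
    have h3 : 2⁻¹ * S ≠ ⊤ := ENNReal.mul_ne_top (by simp) hSt
    conv_lhs at key => rw [e2]
    exact (ENNReal.add_le_add_iff_right h3).1 key
  calc S = 2 * (2⁻¹ * S) := by
        rw [← mul_assoc, ENNReal.mul_inv_cancel (by norm_num) (by norm_num), one_mul]
    _ ≤ 2 * (64 * P) := by gcongr
    _ = 128 * P := by rw [← mul_assoc]; norm_num

end WellPosedness

/-- Theorem 1.3: local well-posedness of vNLW in `𝓗^s(ℝ^d)` for
`s_vis < s ≤ 0`, in the cases `(d ∈ {1,2,3}, k = 2)` or `(d = 1, k = 3)`: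
existence, uniqueness (in the `X(T)`-ball), and Lipschitz continuity of the
data-to-solution map. -/
theorem vNLW_local_wellposedness
    (d k : ℕ) (s : ℝ)
    (hdk : ((d = 1 ∨ d = 2 ∨ d = 3) ∧ k = 2) ∨ (d = 1 ∧ k = 3))
    (hs1 : (d : ℝ) * (1 / 2 - 1 / (k : ℝ)) - 1 / (k : ℝ) < s) (hs2 : s ≤ 0) :
    ∃ C : ℝ, 0 < C ∧ ∀ R : ℝ, 0 < R → ∃ T : ℝ, T ∈ Set.Ioo (0 : ℝ) 1 ∧
      (∀ F₀ F₁ : Edim d → ℂ, MemHsPair d s F₀ F₁ →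
        pairHsNorm d s F₀ F₁ ≤ ENNReal.ofReal R →
        ∃ u : ℝ → Edim d → ℂ, SolProps d k s T (2 * C * R) F₀ F₁ u ∧
          ∀ v : ℝ → Edim d → ℂ, SolProps d k s T (2 * C * R) F₀ F₁ v →
            ∀ t ∈ Set.Icc (0 : ℝ) T, v t =ᵐ[volume] u t) ∧
      ∃ L : ℝ, 0 < L ∧
        ∀ F₀ F₁ G₀ G₁ : Edim d → ℂ, MemHsPair d s F₀ F₁ → MemHsPair d s G₀ G₁ →
          pairHsNorm d s F₀ F₁ ≤ ENNReal.ofReal R →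
          pairHsNorm d s G₀ G₁ ≤ ENNReal.ofReal R →
          ∀ u v : ℝ → Edim d → ℂ, SolProps d k s T (2 * C * R) F₀ F₁ u →
            SolProps d k s T (2 * C * R) G₀ G₁ v →
            (⨆ t ∈ Set.Icc (0 : ℝ) T, HsNorm d s (fun ξ => u t ξ - v t ξ)) ≤
              ENNReal.ofReal L *
                pairHsNorm d s (fun ξ => F₀ ξ - G₀ ξ) (fun ξ => F₁ ξ - G₁ ξ) := by
  obtain ⟨γ₁, γ₂, κ, e⟩ := exists_admissible hdk hs1 hs2
  have hk : 2 ≤ k := by omega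
  refine ⟨64, by norm_num, fun R hR => ?_⟩
  have hB : 0 ≤ 2 * 64 * R := by positivity
  obtain ⟨T, hT, μ, h⟩ := exists_contractive hdk e hB
  have hlip : ∀ {F₀ F₁ G₀ G₁ : Edim d → ℂ} {u v : ℝ → Edim d → ℂ}, MemHsPair d s F₀ F₁ →
      MemHsPair d s G₀ G₁ → SolProps d k s T (2 * 64 * R) F₀ F₁ u →
      SolProps d k s T (2 * 64 * R) G₀ G₁ v → ∀ t ∈ Icc 0 T,
      HsNorm d s (fun ξ => u t ξ - v t ξ) ≤
        128 * pairHsNorm d s (fun ξ => F₀ ξ - G₀ ξ) (fun ξ => F₁ ξ - G₁ ξ) :=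
    fun hF hG hu hv t ht => (HsNorm_le_smoothingNorm (fun t ξ => _ - _) ht).trans
      (h.smoothingNorm_sub_le e hk hT hF.1.1 hF.2.1 hG.1.1 hG.2.1 hu hv)
  refine ⟨T, hT, fun F₀ F₁ hF hFR => ?_, 128, by norm_num,
    fun F₀ F₁ G₀ G₁ hF hG _ _ u v hu hv => iSup₂_le fun t ht => ?_⟩
  · obtain ⟨u, hu⟩ := h.exists_solution e hk hB hT hF.1.1 hF.2.1 (by
      rw [show 2 * 64 * R / 2 = 64 * R by ring, ENNReal.ofReal_mul (by norm_num)]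
      exact mul_le_mul' (by norm_num) hFR)
    refine ⟨u, hu, fun v hv t ht => ?_⟩
    have h0 : HsNorm d s (fun ξ => v t ξ - u t ξ) = 0 := by
      refine nonpos_iff_eq_zero.1 ((hlip hF hF hv hu t ht).trans ?_)
      simp [pairHsNorm, HsNormSq]
    filter_upwards [HsNorm_eq_zero ((hv.1 t ht).1.sub (hu.1 t ht).1) h0] with ξ hξ
    exact sub_eq_zero.1 hξ
  · rw [show ENNReal.ofReal 128 = 128 by norm_num]
    exact hlip hF hG hu hv t ht

end
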